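/- arXiv:1207.5097 — 7 statements merged into one kernel-verified Lean document; each statement's English description precedes it below -/
import Mathlib

section
/- Fix p > 0, c₁ > 0, c₂ > 0 and q > 0, and let T be a random variable on ℝ with density proportional to (1+t²)^{-(q+p+1)/2}. For y ∈ ℝ, suppose s(y) ∈ ℝ minimizes s ↦ ∫_{-∞}^{y} ρ_{c₁,c₂}(t - s)(1+t²)^{-(q+p+1)/2} dt (i.e., s(y) minimizes E[ρ_{c₁,c₂}(T - s) | T ≤ y]), where these integrals are finite. Then for any y₂ < y₁ and any corresponding minimizers, s(y₂) < s(y₁); equivalently, the generalized Bayes function g_{π_l}(y) = -c₀ - s(y) (with q = n + l) is strictly decreasing in y. -/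
open MeasureTheory Set

/-- The asymmetric `L^p` loss `ρ_{c₁,c₂}(t) = c₁|t|^p` for `t < 0` and `c₂ t^p` for `t ≥ 0`. -/
noncomputable def rhoAsym (p c₁ c₂ : ℝ) (t : ℝ) : ℝ :=
  if t < 0 then c₁ * |t| ^ p else c₂ * t ^ p

/-- The truncated posterior objective
`K(y,s) = ∫_{-∞}^{y} ρ_{c₁,c₂}(t-s)(1+t²)^{-(q+p+1)/2} dt`, i.e.
(up to normalization) `E[ρ_{c₁,c₂}(T-s) | T ≤ y]` for `T` with density proportional to
`(1+t²)^{-(q+p+1)/2}`. -/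
noncomputable def truncObj (p c₁ c₂ q : ℝ) (y s : ℝ) : ℝ :=
  ∫ t in Iio y, rhoAsym p c₁ c₂ (t - s) * (1 + t ^ 2) ^ (-((q + p + 1) / 2))

lemma rhoAsym_eq_max {p : ℝ} (hp : 0 < p) (c₁ c₂ t : ℝ) :
    rhoAsym p c₁ c₂ t = c₁ * (max (-t) 0) ^ p + c₂ * (max t 0) ^ p := by
  unfold rhoAsym
  split_ifs with h
  · rw [abs_of_neg h, max_eq_left (by linarith), max_eq_right h.le, Real.zero_rpow hp.ne']
    ring
  · rw [max_eq_right (by linarith), max_eq_left (by linarith), Real.zero_rpow hp.ne']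
    ring

lemma rhoAsym_of_nonneg {t : ℝ} (p c₁ c₂ : ℝ) (ht : 0 ≤ t) :
    rhoAsym p c₁ c₂ t = c₂ * t ^ p := if_neg ht.not_gt

lemma rhoAsym_of_nonpos {p t : ℝ} (hp : 0 < p) (c₁ c₂ : ℝ) (ht : t ≤ 0) :
    rhoAsym p c₁ c₂ t = c₁ * (-t) ^ p := by
  rw [rhoAsym_eq_max hp, max_eq_left (by linarith), max_eq_right ht, Real.zero_rpow hp.ne']
  ring

lemma continuous_rhoAsym {p : ℝ} (hp : 0 < p) (c₁ c₂ : ℝ) : Continuous (rhoAsym p c₁ c₂) := by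
  rw [funext (rhoAsym_eq_max hp c₁ c₂)]
  have h : Continuous fun x : ℝ => x ^ p := Real.continuous_rpow_const hp.le
  exact (continuous_const.mul (h.comp (by fun_prop : Continuous fun t : ℝ => max (-t) 0))).add
    (continuous_const.mul (h.comp (by fun_prop : Continuous fun t : ℝ => max t 0)))

lemma strictMonoOn_rhoAsym {p c₂ : ℝ} (hp : 0 < p) (c₁ : ℝ) (hc₂ : 0 < c₂) :
    StrictMonoOn (rhoAsym p c₁ c₂) (Ici 0) := by
  intro a ha b hb hab
  rw [rhoAsym_of_nonneg _ _ _ ha, rhoAsym_of_nonneg _ _ _ hb]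
  exact mul_lt_mul_of_pos_left (Real.rpow_lt_rpow ha hab hp) hc₂

lemma strictAntiOn_rhoAsym {p c₁ : ℝ} (hp : 0 < p) (hc₁ : 0 < c₁) (c₂ : ℝ) :
    StrictAntiOn (rhoAsym p c₁ c₂) (Iic 0) := by
  intro a ha b hb hab
  simp only [mem_Iic] at ha hb
  rw [rhoAsym_of_nonpos hp _ _ ha, rhoAsym_of_nonpos hp _ _ hb]
  exact mul_lt_mul_of_pos_left (Real.rpow_lt_rpow (by linarith) (by linarith) hp) hc₁

/-- The difference of two shifted losses changes sign at most once, from negative to positive. -/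
lemma rhoAsym_sub_lt_of_le {p c₁ c₂ : ℝ} (hp : 0 < p) (hc₁ : 0 < c₁) (hc₂ : 0 < c₂)
    {s₁ s₂ t t' : ℝ} (hs : s₁ < s₂) (htt' : t < t')
    (h : rhoAsym p c₁ c₂ (t - s₂) ≤ rhoAsym p c₁ c₂ (t - s₁)) :
    rhoAsym p c₁ c₂ (t' - s₂) < rhoAsym p c₁ c₂ (t' - s₁) := by
  have hmono := strictMonoOn_rhoAsym hp c₁ hc₂
  have hanti := strictAntiOn_rhoAsym hp hc₁ c₂
  have ht : s₁ < t := by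
    by_contra! hle
    exact h.not_gt (hanti (mem_Iic.2 (by linarith)) (mem_Iic.2 (by linarith)) (by linarith))
  rcases le_total s₂ t' with h2 | h2
  · exact hmono (mem_Ici.2 (by linarith)) (mem_Ici.2 (by linarith)) (by linarith)
  · calc rhoAsym p c₁ c₂ (t' - s₂) < rhoAsym p c₁ c₂ (t - s₂) :=
          hanti (mem_Iic.2 (by linarith)) (mem_Iic.2 (by linarith)) (by linarith)
      _ ≤ rhoAsym p c₁ c₂ (t - s₁) := h
      _ < rhoAsym p c₁ c₂ (t' - s₁) :=
          hmono (mem_Ici.2 (by linarith)) (mem_Ici.2 (by linarith)) (by linarith)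

/-- A linear lower bound for the increments of `x ↦ x ^ p` away from `0` and `∞`. -/
lemma mul_sub_le_rpow_sub_rpow {p δ M a b : ℝ} (hp : 0 < p) (hδ : 0 < δ) (ha : δ ≤ a)
    (hab : a ≤ b) (hb : b ≤ M) : p * (δ ^ p / M) * (b - a) ≤ b ^ p - a ^ p := by
  have hderiv : ∀ x ∈ Icc δ M, HasDerivAt (fun x : ℝ => x ^ p) (p * x ^ (p - 1)) x :=
    fun x hx => Real.hasDerivAt_rpow_const (Or.inl (hδ.trans_le hx.1).ne')
  refine (convex_Icc δ M).mul_sub_le_image_sub_of_le_deriv (f := fun x : ℝ => x ^ p)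
    (fun x hx => (hderiv x hx).continuousAt.continuousWithinAt)
    (fun x hx => (hderiv x (interior_subset hx)).differentiableAt.differentiableWithinAt)
    ?_ a ⟨ha, hab.trans hb⟩ b ⟨ha.trans hab, hb⟩ hab
  intro x hx
  have hx := interior_subset hx
  have hx0 : 0 < x := hδ.trans_le hx.1
  rw [(hderiv x hx).deriv, Real.rpow_sub_one hx0.ne']
  have := Real.rpow_le_rpow hδ.le hx.1 hp.le
  have := hx.2
  gcongr

lemma setIntegral_pos_of_pos {f : ℝ → ℝ} {s : Set ℝ} (hs : MeasurableSet s)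
    (hf : ∀ x ∈ s, 0 < f x) (hfi : IntegrableOn f s) (hvol : 0 < volume s) :
    0 < ∫ x in s, f x := by
  rw [setIntegral_pos_iff_support_of_nonneg_ae
    ((ae_restrict_iff' hs).2 (ae_of_all _ fun x hx => (hf x hx).le)) hfi]
  rwa [inter_eq_right.2 fun x hx => Function.mem_support.2 (hf x hx).ne']

lemma continuous_one_add_sq_rpow (r : ℝ) : Continuous fun t : ℝ => (1 + t ^ 2) ^ r :=
  (by fun_prop : Continuous fun t : ℝ => 1 + t ^ 2).rpow_const
    fun t => Or.inl (by positivity)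

lemma one_add_sq_rpow_neg_le {m a b : ℝ} (hm : 0 ≤ m) (hab : |a - b| ≤ 1) :
    (1 + a ^ 2) ^ (-m) ≤ 3 ^ m * (1 + b ^ 2) ^ (-m) := by
  have h1 : (a - b) ^ 2 ≤ 1 := by rw [← sq_abs]; nlinarith [abs_nonneg (a - b)]
  have h2 : 1 + b ^ 2 ≤ 3 * (1 + a ^ 2) := by nlinarith [sq_nonneg (2 * a - b)]
  have h3 : (1 + b ^ 2) ^ m ≤ 3 ^ m * (1 + a ^ 2) ^ m := by
    rw [← Real.mul_rpow (by norm_num) (by positivity)]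
    exact Real.rpow_le_rpow (by positivity) h2 hm
  rw [Real.rpow_neg (by positivity), Real.rpow_neg (by positivity), ← div_eq_mul_inv,
    le_div_iff₀ (by positivity), inv_mul_le_iff₀ (by positivity)]
  linarith

lemma hasDerivAt_one_add_sq_rpow (r t : ℝ) :
    HasDerivAt (fun t : ℝ => (1 + t ^ 2) ^ r) (2 * t * r * (1 + t ^ 2) ^ (r - 1)) t := by
  have h : HasDerivAt (fun t : ℝ => 1 + t ^ 2) (2 * t) t := by
    simpa using (hasDerivAt_pow 2 t).const_add 1
  exact h.rpow_const (Or.inl (by positivity))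

lemma abs_deriv_one_add_sq_rpow_le {m : ℝ} (hm : 0 ≤ m) (t : ℝ) :
    |2 * t * (-m) * (1 + t ^ 2) ^ (-m - 1)| ≤ m * (1 + t ^ 2) ^ (-m) := by
  have h0 : (0 : ℝ) < 1 + t ^ 2 := by positivity
  rw [Real.rpow_sub_one h0.ne', abs_mul, abs_of_nonneg (a := _ / _) (by positivity),
    mul_div_assoc', div_le_iff₀ h0, abs_mul, abs_neg, abs_of_nonneg hm]
  have h : |2 * t| ≤ 1 + t ^ 2 := abs_le.2 ⟨by nlinarith [sq_nonneg (t + 1)],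
    by nlinarith [sq_nonneg (t - 1)]⟩
  have h' : 0 ≤ m * (1 + t ^ 2) ^ (-m) := by positivity
  nlinarith [mul_le_mul_of_nonneg_left h h']

lemma hasDerivAt_sub_mul_of_continuousAt {g : ℝ → ℝ} {a : ℝ} (hg : ContinuousAt g a) :
    HasDerivAt (fun x => (x - a) * g x) (g a) a := by
  rw [hasDerivAt_iff_tendsto_slope]
  refine (hg.tendsto.mono_left nhdsWithin_le_nhds).congr' ?_
  filter_upwards [self_mem_nhdsWithin] with x hx
  have : x - a ≠ 0 := sub_ne_zero.2 hx
  simp [slope_def_field, this]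

lemma not_hasDerivAt_zero_of_linear_growth {f : ℝ → ℝ} {s b c : ℝ} (hc : 0 < c) (hb : s < b)
    (hf : ∀ x, s < x → x ≤ b → c * (x - s) ≤ f x - f s) : ¬ HasDerivAt f 0 s := by
  intro h
  have h1 := (hasDerivAt_iff_tendsto_slope.1 h).mono_left
    (nhdsWithin_mono s (fun x hx => (mem_Ioi.1 hx).ne' : Ioi s ⊆ {s}ᶜ))
  refine hc.not_ge (ge_of_tendsto h1 ?_)
  filter_upwards [Ioc_mem_nhdsGT hb] with x hx
  rw [slope_def_field, le_div_iff₀ (sub_pos.2 hx.1)]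
  exact hf x hx.1 hx.2

/-- Integrals of `φ (t - s) * w t` over a half-line depend differentiably on the shift `s`. -/
lemma differentiableAt_setIntegral_Iio_sub_mul {φ w w' : ℝ → ℝ} {C D : ℝ} (hφ : Continuous φ)
    (hw : Continuous w) (hw' : ∀ t, HasDerivAt w (w' t) t) (hw0 : ∀ t, 0 ≤ w t) (hC : 0 ≤ C)
    (hbound : ∀ t, |w' t| ≤ C * w t) (hshift : ∀ a b, |a - b| ≤ 1 → w a ≤ D * w b)
    (hfin : ∀ y s, IntegrableOn (fun t => φ (t - s) * w t) (Iio y)) (y s : ℝ) :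
    DifferentiableAt ℝ (fun x => ∫ t in Iio y, φ (t - x) * w t) s := by
  have hpre : ∀ x z : ℝ, (fun u => u + x) ⁻¹' (Iio z) = Iio (z - x) := fun x z => by
    simp
  have hint : ∀ x b, IntegrableOn (fun u => φ u * w (u + x)) (Iio b) := by
    intro x b
    have := ((measurePreserving_add_right volume x).integrableOn_comp_preimage
      (measurableEmbedding_addRight x)).2 (hfin (b + x) x)
    rw [hpre] at this
    simpa [Function.comp_def] using this
  have hchange : ∀ x, ∫ t in Iio y, φ (t - x) * w t = ∫ u in Iio (y - x), φ u * w (u + x) := by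
    intro x
    have := (measurePreserving_add_right volume x).setIntegral_preimage_emb
      (measurableEmbedding_addRight x) (fun t => φ (t - x) * w t) (Iio y)
    rw [hpre] at this
    simpa using this.symm
  have hsplit : ∀ x, ∫ t in Iio y, φ (t - x) * w t = (∫ u in Iio (y - s), φ u * w (u + x)) +
      (x - s) * -∫ θ in (0 : ℝ)..1, φ (y - s + (s - x) * θ) * w (y - s + (s - x) * θ + x) := by
    intro x
    have h1 := intervalIntegral.mul_integral_comp_add_mul (a := 0) (b := 1)
      (f := fun u => φ u * w (u + x)) (s - x) (y - s)
    have h2 := intervalIntegral.integral_Iic_sub_Iic (μ := volume)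
      ((integrableOn_Iic_iff_integrableOn_Iio).2 (hint x (y - s)))
      ((integrableOn_Iic_iff_integrableOn_Iio).2 (hint x (y - x)))
    rw [integral_Iic_eq_integral_Iio, integral_Iic_eq_integral_Iio] at h2
    rw [show y - s + (s - x) * 0 = y - s by ring, show y - s + (s - x) * 1 = y - x by ring] at h1
    rw [hchange]
    linarith
  rw [funext hsplit]
  refine DifferentiableAt.add ?_ ?_
  · refine (hasDerivAt_integral_of_dominated_loc_of_deriv_le (μ := volume.restrict (Iio (y - s)))
      (F := fun x u => φ u * w (u + x)) (F' := fun x u => φ u * w' (u + x))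
      (bound := fun u => C * D * |φ u * w (u + s)|)
      (Metric.ball_mem_nhds s one_pos) (.of_forall fun x => ?_) (hint s _) ?_ ?_
      ((hint s _).abs.const_mul _) ?_).2.differentiableAt
    · exact (by fun_prop : Continuous fun u => φ u * w (u + x)).aestronglyMeasurable
    · have : w' = deriv w := funext fun t => (hw' t).deriv.symm
      rw [this]
      exact (hφ.measurable.mul ((measurable_deriv w).comp
        (measurable_id.add_const s))).aestronglyMeasurable
    · refine .of_forall fun u x hx => ?_
      have hd : |u + x - (u + s)| ≤ 1 := by
        rw [add_sub_add_left_eq_sub, ← Real.dist_eq]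
        exact (Metric.mem_ball.1 hx).le
      rw [Real.norm_eq_abs, abs_mul, abs_mul, abs_of_nonneg (hw0 _)]
      calc |φ u| * |w' (u + x)| ≤ |φ u| * (C * (D * w (u + s))) := by
            refine mul_le_mul_of_nonneg_left ((hbound _).trans ?_) (abs_nonneg _)
            exact mul_le_mul_of_nonneg_left (hshift _ _ hd) hC
        _ = C * D * (|φ u| * w (u + s)) := by ring
    · exact .of_forall fun u x _ => ((hw' (u + x)).comp_const_add u x).const_mul _
  · refine (hasDerivAt_sub_mul_of_continuousAt (Continuous.continuousAt ?_)).differentiableAt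
    refine (intervalIntegral.continuous_parametric_intervalIntegral_of_continuous' ?_ 0 1).neg
    fun_prop

lemma differentiableAt_truncObj {p c₁ c₂ q : ℝ} (hp : 0 < p) (hq : 0 < q)
    (h_fin : ∀ y s : ℝ, IntegrableOn
      (fun t => rhoAsym p c₁ c₂ (t - s) * (1 + t ^ 2) ^ (-((q + p + 1) / 2))) (Iio y))
    (y s : ℝ) : DifferentiableAt ℝ (truncObj p c₁ c₂ q y) s := by
  have hm : 0 ≤ (q + p + 1) / 2 := by positivity
  exact differentiableAt_setIntegral_Iio_sub_mul (continuous_rhoAsym hp c₁ c₂)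
    (continuous_one_add_sq_rpow _) (hasDerivAt_one_add_sq_rpow _)
    (fun t => by positivity) hm (abs_deriv_one_add_sq_rpow_le hm)
    (fun _ _ => one_add_sq_rpow_neg_le hm) h_fin y s

/-- Lemma 5(b) (valid for all p > 0): minimizers of the truncated objective are strictly
increasing in the truncation point `y`; equivalently the generalized Bayes function
`g_{π_l}(y) = -c₀ - s(y)` is strictly decreasing in `y`. -/
theorem stmt10
    (p c₁ c₂ q : ℝ) (hp : 0 < p) (hc₁ : 0 < c₁) (hc₂ : 0 < c₂) (hq : 0 < q)
    -- finiteness of the integrals involved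
    (h_fin : ∀ y s : ℝ, IntegrableOn
      (fun t => rhoAsym p c₁ c₂ (t - s) * (1 + t ^ 2) ^ (-((q + p + 1) / 2))) (Iio y)) :
    ∀ y₁ y₂ s₁ s₂ : ℝ, y₂ < y₁ →
      (∀ s : ℝ, truncObj p c₁ c₂ q y₂ s₂ ≤ truncObj p c₁ c₂ q y₂ s) →
      (∀ s : ℝ, truncObj p c₁ c₂ q y₁ s₁ ≤ truncObj p c₁ c₂ q y₁ s) →
      s₂ < s₁ := by
  intro y₁ y₂ s₁ s₂ hy hmin₂ hmin₁
  set w : ℝ → ℝ := fun t => (1 + t ^ 2) ^ (-((q + p + 1) / 2)) with hw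
  have hw0 : ∀ t, 0 < w t := fun t => by positivity
  have hwint : ∀ a b, IntegrableOn w (Ico a b) := fun a b =>
    ((continuous_one_add_sq_rpow _).integrableOn_Icc (a := a) (b := b)).mono_set Ico_subset_Icc_self
  have hwpos : ∀ a b, a < b → 0 < ∫ t in Ico a b, w t := fun a b hab =>
    setIntegral_pos_of_pos measurableSet_Ico (fun t _ => hw0 t) (hwint a b) (by simpa using hab)
  set f : ℝ → ℝ → ℝ := fun s t => rhoAsym p c₁ c₂ (t - s) * w t with hf
  have hK : ∀ y s, truncObj p c₁ c₂ q y s = ∫ t in Iio y, f s t := fun _ _ => rfl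
  have hfIco : ∀ s, IntegrableOn (f s) (Ico y₂ y₁) := fun s =>
    (h_fin y₁ s).mono_set Ico_subset_Iio_self
  have hsplit : ∀ s, truncObj p c₁ c₂ q y₁ s =
      truncObj p c₁ c₂ q y₂ s + ∫ t in Ico y₂ y₁, f s t := by
    intro s
    rw [hK, hK, ← setIntegral_union _ measurableSet_Ico (h_fin y₂ s) (hfIco s),
      Iio_union_Ico_eq_Iio hy.le]
    exact disjoint_left.2 fun t ht ht' => (mem_Iio.1 ht).not_ge ht'.1
  by_contra! hle
  rcases hle.lt_or_eq with hlt | rfl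
  · have h2 : ∃ t < y₂, rhoAsym p c₁ c₂ (t - s₂) ≤ rhoAsym p c₁ c₂ (t - s₁) := by
      by_contra! hneg
      have := setIntegral_pos_of_pos (f := fun t => f s₂ t - f s₁ t) (measurableSet_Iio (a := y₂))
        (fun t ht => sub_pos.2 (mul_lt_mul_of_pos_right (hneg t ht) (hw0 t)))
        ((h_fin y₂ s₂).sub (h_fin y₂ s₁)) (by simp)
      rw [integral_sub (h_fin y₂ s₂) (h_fin y₂ s₁), ← hK, ← hK] at this
      linarith [hmin₂ s₁]
    obtain ⟨t, ht, hle⟩ := h2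
    have := setIntegral_pos_of_pos (f := fun t => f s₁ t - f s₂ t)
      (measurableSet_Ico (a := y₂) (b := y₁))
      (fun x hx => sub_pos.2 (mul_lt_mul_of_pos_right
        (rhoAsym_sub_lt_of_le hp hc₁ hc₂ hlt (ht.trans_le hx.1) hle) (hw0 x)))
      ((hfIco s₁).sub (hfIco s₂)) (by simpa using hy)
    rw [integral_sub (hfIco s₁) (hfIco s₂)] at this
    linarith [hmin₂ s₁, hmin₁ s₂, hsplit s₁, hsplit s₂]
  · have hderiv : ∀ y, (∀ s, truncObj p c₁ c₂ q y s₁ ≤ truncObj p c₁ c₂ q y s) →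
        HasDerivAt (truncObj p c₁ c₂ q y) 0 s₁ := by
      intro y hmin
      have hd := (differentiableAt_truncObj hp hq h_fin y s₁).hasDerivAt
      have hloc : IsLocalMin (truncObj p c₁ c₂ q y) s₁ := .of_forall hmin
      rwa [hloc.deriv_eq_zero] at hd
    rcases lt_or_ge s₁ y₂ with hs | hs
    · set k : ℝ := p * (((y₂ - s₁) / 2) ^ p / (y₁ - s₁)) with hk
      have hk0 : 0 < k := mul_pos hp
        (div_pos (Real.rpow_pos_of_pos (by linarith) p) (by linarith))
      refine not_hasDerivAt_zero_of_linear_growth (s := s₁) (b := (s₁ + y₂) / 2)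
        (f := truncObj p c₁ c₂ q y₂ - truncObj p c₁ c₂ q y₁)
        (mul_pos (mul_pos hc₂ hk0) (hwpos y₂ y₁ hy)) (by linarith) (fun x hx hxb => ?_)
        (by simpa using (hderiv y₂ hmin₂).sub (hderiv y₁ hmin₁))
      have hmono : ∫ t in Ico y₂ y₁, c₂ * k * (x - s₁) * w t ≤
          ∫ t in Ico y₂ y₁, (f s₁ t - f x t) := by
        refine setIntegral_mono_on ((hwint _ _).const_mul _) ((hfIco s₁).sub (hfIco x))
          measurableSet_Ico fun t ht => ?_
        have hincr := mul_sub_le_rpow_sub_rpow (δ := (y₂ - s₁) / 2) (M := y₁ - s₁)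
          (a := t - x) (b := t - s₁) hp (by linarith) (by linarith [ht.1]) (by linarith)
          (by linarith [ht.2])
        simp only [hf]
        rw [rhoAsym_of_nonneg _ _ _ (by linarith [ht.1] : 0 ≤ t - s₁),
          rhoAsym_of_nonneg _ _ _ (by linarith [ht.1] : 0 ≤ t - x), ← sub_mul]
        refine mul_le_mul_of_nonneg_right ?_ (hw0 t).le
        rw [sub_sub_sub_cancel_left, ← hk] at hincr
        nlinarith
      rw [integral_const_mul, integral_sub (hfIco s₁) (hfIco x)] at hmono
      simp only [Pi.sub_apply]
      linarith [hsplit s₁, hsplit x]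
    · set k : ℝ := p * (1 ^ p / (s₁ - y₂ + 3)) with hk
      have hk0 : 0 < k := mul_pos hp
        (div_pos (Real.rpow_pos_of_pos one_pos p) (by linarith))
      refine not_hasDerivAt_zero_of_linear_growth (s := s₁) (b := s₁ + 1)
        (mul_pos (mul_pos hc₁ hk0) (hwpos (y₂ - 2) (y₂ - 1) (by linarith))) (by linarith)
        (fun x hx hxb => ?_) (hderiv y₂ hmin₂)
      have hsub : Ico (y₂ - 2) (y₂ - 1) ⊆ Iio y₂ := fun t ht => mem_Iio.2 (by linarith [ht.2])
      have hdiff : IntegrableOn (fun t => f x t - f s₁ t) (Iio y₂) :=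
        (h_fin y₂ x).sub (h_fin y₂ s₁)
      have hmono : ∫ t in Ico (y₂ - 2) (y₂ - 1), c₁ * k * (x - s₁) * w t ≤
          ∫ t in Ico (y₂ - 2) (y₂ - 1), (f x t - f s₁ t) := by
        refine setIntegral_mono_on ((hwint _ _).const_mul _) (hdiff.mono_set hsub)
          measurableSet_Ico fun t ht => ?_
        have hincr := mul_sub_le_rpow_sub_rpow (δ := 1) (M := s₁ - y₂ + 3)
          (a := -(t - s₁)) (b := -(t - x)) hp one_pos (by linarith [ht.2]) (by linarith)
          (by linarith [ht.1])
        simp only [hf]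
        rw [rhoAsym_of_nonpos hp _ _ (by linarith [ht.2] : t - s₁ ≤ 0),
          rhoAsym_of_nonpos hp _ _ (by linarith [ht.2] : t - x ≤ 0), ← sub_mul]
        refine mul_le_mul_of_nonneg_right ?_ (hw0 t).le
        rw [show -(t - x) - -(t - s₁) = x - s₁ by ring, ← hk] at hincr
        nlinarith
      have hle : ∫ t in Ico (y₂ - 2) (y₂ - 1), (f x t - f s₁ t) ≤
          ∫ t in Iio y₂, (f x t - f s₁ t) := by
        refine setIntegral_mono_set hdiff ?_ hsub.eventuallyLE
        refine (ae_restrict_iff' measurableSet_Iio).2 (ae_of_all _ fun t ht => sub_nonneg.2 ?_)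
        have ht : t < y₂ := ht
        exact mul_le_mul_of_nonneg_right ((strictAntiOn_rhoAsym hp hc₁ c₂).antitoneOn
          (mem_Iic.2 (by linarith)) (mem_Iic.2 (by linarith)) (by linarith)) (hw0 t).le
      rw [integral_const_mul] at hmono
      rw [integral_sub (h_fin y₂ x) (h_fin y₂ s₁), ← hK, ← hK] at hle
      linarith
end

section
/- Consider the normal model and let ρ be a convex, even, strictly bowl-shaped, absolutely continuous loss (so c₀ = 0). For m > 0 and y ∈ ℝ, let z_m(y) be the unique real number satisfying ∫₀^∞∫_{-∞}^{vy} ρ'(u + z_m(y)·v) v^m e^{-(u²+v²)/2} du dv = 0 and y + z_m(y) ≥ 0, assuming all integrals converge and differentiation under the integral sign in m is valid. Then for each fixed y ∈ ℝ, m ↦ z_m(y) is nonincreasing: m₁ ≤ m₂ implies z_{m₁}(y) ≥ z_{m₂}(y). Equivalently, for the normal model in canonical form, the generalized Bayes functions g_{π_l}(y) (with m = n + l) are nonincreasing in l. -/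
open MeasureTheory Set

/-- Slices of a function that is integrable on the sector `{0 < v, u < v y}`. -/
lemma integrableOn_sector_slices {f : ℝ × ℝ → ℝ} {y : ℝ}
    (hf : IntegrableOn f {pr : ℝ × ℝ | 0 < pr.2 ∧ pr.1 < pr.2 * y}) :
    IntegrableOn (fun v => ∫ u in Iio (v * y), f (u, v)) (Ioi 0) ∧
      ∀ᵐ v ∂volume.restrict (Ioi (0 : ℝ)), IntegrableOn (fun u => f (u, v)) (Iio (v * y)) := by
  have hS : MeasurableSet {pr : ℝ × ℝ | 0 < pr.2 ∧ pr.1 < pr.2 * y} :=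
    (measurableSet_lt measurable_const measurable_snd).inter
      (measurableSet_lt measurable_fst (measurable_snd.mul_const y))
  have hi := (integrable_indicator_iff hS).2 hf
  rw [Measure.volume_eq_prod] at hi
  have slice : ∀ v ∈ Ioi (0 : ℝ), (fun u => indicator
      {pr : ℝ × ℝ | 0 < pr.2 ∧ pr.1 < pr.2 * y} f (u, v)) =
      indicator (Iio (v * y)) (fun u => f (u, v)) := by
    intro v hv
    funext u
    have hv' : 0 < v := hv
    simp [indicator, hv']
  constructor
  · refine (hi.integral_prod_right.integrableOn (s := Ioi 0)).congr_fun ?_ measurableSet_Ioi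
    intro v hv
    change ∫ u, indicator _ f (u, v) = _
    rw [slice v hv, integral_indicator measurableSet_Iio]
  · rw [ae_restrict_iff' measurableSet_Ioi]
    filter_upwards [hi.prod_left_ae] with v hv hv0
    rw [slice v hv0] at hv
    exact (integrable_indicator_iff measurableSet_Iio).1 hv

/-- The derivative of an even convex function is odd almost everywhere. -/
lemma ae_odd_of_even_primitive {ρ ρd : ℝ → ℝ} (hmono : Monotone ρd)
    (hftc : ∀ a b : ℝ, ρ b - ρ a = ∫ t in a..b, ρd t) (heven : ∀ t, ρ (-t) = ρ t) :
    ∀ᵐ t : ℝ, ρd (-t) = -ρd t := by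
  have hderiv : ∀ t, ContinuousAt ρd t → HasDerivAt ρ (ρd t) t := by
    intro t ht
    have h := intervalIntegral.integral_hasDerivAt_right (a := 0) (b := t)
      (hmono.intervalIntegrable) (hmono.measurable.stronglyMeasurable.stronglyMeasurableAtFilter) ht
    have h2 : ρ = fun b => (∫ t in (0 : ℝ)..b, ρd t) + ρ 0 := by
      funext b
      rw [← hftc]; ring
    rw [h2]
    exact h.add_const _
  have hc : {t : ℝ | ¬ContinuousAt ρd t}.Countable := hmono.countable_not_continuousAt
  have h1 : ∀ᵐ t : ℝ, ContinuousAt ρd t := by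
    rw [ae_iff]; exact hc.measure_zero _
  have h2 : ∀ᵐ t : ℝ, ContinuousAt ρd (-t) := by
    rw [ae_iff]
    refine Set.Countable.measure_zero ?_ _
    exact hc.preimage neg_injective
  filter_upwards [h1, h2] with t ht hnt
  have e1 := hderiv t ht
  have e2 : HasDerivAt (fun s => ρ (-s)) (ρd (-t) * (-1)) t :=
    (hderiv (-t) hnt).comp t (hasDerivAt_neg t)
  rw [show (fun s => ρ (-s)) = ρ from funext heven] at e2
  linarith [e1.unique e2]

/-- Truncating an odd function, negative on the negative axis, at a nonnegative level leaves a
nonpositive integral. -/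
lemma setIntegral_Iio_nonpos_of_ae_odd {f : ℝ → ℝ} {a : ℝ} (ha : 0 ≤ a)
    (hodd : ∀ᵐ t : ℝ, f (-t) = -f t) (hneg : ∀ t < 0, f t ≤ 0) (hf : IntegrableOn f (Iio a)) :
    ∫ t in Iio a, f t ≤ 0 := by
  have hf' : IntegrableOn f (Iic a) := (integrableOn_Iic_iff_integrableOn_Iio (by simp)).2 hf
  have hsplit := intervalIntegral.integral_Iic_sub_Iic
    (hf'.mono_set (Iic_subset_Iic.2 (by linarith : -a ≤ a))) hf'
  have hsymm : ∫ t in (-a)..a, f t = 0 := by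
    have h1 : ∫ t in (-a)..a, f (-t) = ∫ t in (-a)..a, f t := by
      simp
    have h2 : ∫ t in (-a)..a, f (-t) = ∫ t in (-a)..a, -f t :=
      intervalIntegral.integral_congr_ae (hodd.mono fun t ht _ => ht)
    rw [intervalIntegral.integral_neg] at h2
    linarith
  have hle : ∫ t in Iio (-a), f t ≤ 0 :=
    setIntegral_nonpos measurableSet_Iio fun t ht => hneg t (by have : t < -a := ht; linarith)
  rw [integral_Iic_eq_integral_Iio, integral_Iic_eq_integral_Iio, hsymm] at hsplit
  linarith

/-- If `B` is nondecreasing on a set of full measure and a positive weight balances `B`, then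
multiplying the weight by `v ^ d` with `d ≥ 0` tilts the balance upwards. -/
lemma setIntegral_rpow_mul_nonneg {B w : ℝ → ℝ} {d : ℝ} (hd : 0 ≤ d) {V : Set ℝ}
    (hV : ∀ᵐ v ∂volume.restrict (Ioi (0 : ℝ)), v ∈ V) (hB : MonotoneOn B (V ∩ Ioi 0))
    (hw : ∀ v > 0, 0 < w v) (h1 : IntegrableOn (fun v => w v * B v) (Ioi 0))
    (h2 : IntegrableOn (fun v => v ^ d * (w v * B v)) (Ioi 0))
    (h0 : ∫ v in Ioi (0 : ℝ), w v * B v = 0) :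
    0 ≤ ∫ v in Ioi (0 : ℝ), v ^ d * (w v * B v) := by
  have hpos : ∀ᵐ v ∂volume.restrict (Ioi (0 : ℝ)), 0 < v :=
    ae_restrict_mem measurableSet_Ioi
  by_cases hne : ∃ v ∈ V ∩ Ioi 0, 0 ≤ B v
  · set N : Set ℝ := {v | v ∈ V ∩ Ioi 0 ∧ 0 ≤ B v} with hN
    have hNne : N.Nonempty := by
      obtain ⟨v, hv, hBv⟩ := hne
      exact ⟨v, hv, hBv⟩
    have hNbdd : BddBelow N := ⟨0, fun v hv => le_of_lt hv.1.2⟩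
    have hs0 : 0 ≤ sInf N := le_csInf hNne fun v hv => le_of_lt hv.1.2
    have hle : ∫ v in Ioi (0 : ℝ), sInf N ^ d * (w v * B v) ≤
        ∫ v in Ioi (0 : ℝ), v ^ d * (w v * B v) := by
      refine integral_mono_ae (h1.const_mul _) h2 ?_
      filter_upwards [hV, hpos] with v hv hv0
      have hwv := hw v hv0
      rcases lt_or_ge (B v) 0 with hBv | hBv
      · have hvs : v ≤ sInf N := by
          refine le_csInf hNne fun x hx => ?_
          by_contra hlt
          have := hB hx.1 ⟨hv, hv0⟩ (le_of_not_ge hlt)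
          linarith [hx.2]
        exact mul_le_mul_of_nonpos_right (Real.rpow_le_rpow hv0.le hvs hd)
          (mul_nonpos_of_nonneg_of_nonpos hwv.le hBv.le)
      · have hvs : sInf N ≤ v := csInf_le hNbdd ⟨⟨hv, hv0⟩, hBv⟩
        exact mul_le_mul_of_nonneg_right (Real.rpow_le_rpow hs0 hvs hd)
          (mul_nonneg hwv.le hBv)
    rw [integral_const_mul, h0, mul_zero] at hle
    exact hle
  · push Not at hne
    have hnn : 0 ≤ᵐ[volume.restrict (Ioi (0 : ℝ))] fun v => -(w v * B v) := by
      filter_upwards [hV, hpos] with v hv hv0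
      have := mul_neg_of_pos_of_neg (hw v hv0) (hne v ⟨hv, hv0⟩)
      simp only [Pi.zero_apply]
      linarith
    have hzero := (integral_eq_zero_iff_of_nonneg_ae hnn h1.neg).1 (by
      rw [integral_neg, h0, neg_zero])
    refine integral_nonneg_of_ae ?_
    filter_upwards [hzero] with v hv
    have : w v * B v = 0 := by simpa using hv
    simp [this]

/-- The inner integrand after the substitution `t = u + c v`, without its factor depending on `v`
alone. -/
noncomputable def tiltedLoss (ρd : ℝ → ℝ) (w c v : ℝ) : ℝ → ℝ :=
  indicator (Iio (v * w)) fun t => ρd t * Real.exp (-t ^ 2 / 2 + c * v * t)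

lemma indicator_eq_tiltedLoss (ρd : ℝ → ℝ) (y c v u : ℝ) :
    indicator (Iio (v * y)) (fun u => ρd (u + c * v) * Real.exp (-u ^ 2 / 2)) u =
      Real.exp (-(c * v) ^ 2 / 2) * tiltedLoss ρd (y + c) c v (u + c * v) := by
  have hiff : u + c * v < v * (y + c) ↔ u < v * y := by
    constructor <;> intro h <;> linarith
  by_cases h : u < v * y
  · rw [tiltedLoss, indicator_of_mem (show u ∈ Iio (v * y) from h),
      indicator_of_mem (show u + c * v ∈ Iio (v * (y + c)) from hiff.2 h),
      mul_left_comm, ← Real.exp_add]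
    ring_nf
  · rw [tiltedLoss, indicator_of_notMem (show u ∉ Iio (v * y) from h),
      indicator_of_notMem (show u + c * v ∉ Iio (v * (y + c)) from mt hiff.1 h), mul_zero]

lemma setIntegral_eq_integral_tiltedLoss (ρd : ℝ → ℝ) (y c v : ℝ) :
    ∫ u in Iio (v * y), ρd (u + c * v) * Real.exp (-u ^ 2 / 2) =
      Real.exp (-(c * v) ^ 2 / 2) * ∫ t, tiltedLoss ρd (y + c) c v t := by
  rw [← integral_indicator measurableSet_Iio, ← integral_const_mul,
    ← integral_add_right_eq_self
      (fun t => Real.exp (-(c * v) ^ 2 / 2) * tiltedLoss ρd (y + c) c v t) (c * v)]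
  exact integral_congr_ae (.of_forall fun u => indicator_eq_tiltedLoss ρd y c v u)

lemma integrable_tiltedLoss {ρd : ℝ → ℝ} {y c v : ℝ}
    (h : IntegrableOn (fun u => ρd (u + c * v) * Real.exp (-u ^ 2 / 2)) (Iio (v * y))) :
    Integrable (tiltedLoss ρd (y + c) c v) := by
  have h1 := (integrable_indicator_iff measurableSet_Iio).2 h
  rw [show indicator (Iio (v * y)) (fun u => ρd (u + c * v) * Real.exp (-u ^ 2 / 2)) =
    fun u => Real.exp (-(c * v) ^ 2 / 2) * tiltedLoss ρd (y + c) c v (u + c * v) from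
    funext fun u => indicator_eq_tiltedLoss ρd y c v u] at h1
  have h2 := (h1.const_mul (Real.exp (-(c * v) ^ 2 / 2))⁻¹).comp_sub_right (c * v)
  refine h2.congr (.of_forall fun t => ?_)
  simp

lemma tiltedLoss_mono {ρd : ℝ → ℝ} (hneg : ∀ t < (0 : ℝ), ρd t < 0)
    (hpos : ∀ t > (0 : ℝ), 0 < ρd t) {w c v₁ v₂ : ℝ} (hw : 0 ≤ w) (hc : 0 ≤ c) (hv₁ : 0 < v₁)
    (hv : v₁ ≤ v₂) (t : ℝ) : tiltedLoss ρd w c v₁ t ≤ tiltedLoss ρd w c v₂ t := by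
  have hvw : v₁ * w ≤ v₂ * w := mul_le_mul_of_nonneg_right hv hw
  have hcv : c * v₁ ≤ c * v₂ := mul_le_mul_of_nonneg_left hv hc
  unfold tiltedLoss
  by_cases h1 : t < v₁ * w
  · rw [indicator_of_mem (show t ∈ Iio (v₁ * w) from h1),
      indicator_of_mem (show t ∈ Iio (v₂ * w) from h1.trans_le hvw)]
    rcases lt_trichotomy t 0 with ht | rfl | ht
    · refine mul_le_mul_of_nonpos_left (Real.exp_le_exp.2 ?_) (hneg t ht).le
      linarith [mul_le_mul_of_nonpos_right hcv ht.le]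
    · simp
    · refine mul_le_mul_of_nonneg_left (Real.exp_le_exp.2 ?_) (hpos t ht).le
      linarith [mul_le_mul_of_nonneg_right hcv ht.le]
  · rw [indicator_of_notMem (show t ∉ Iio (v₁ * w) from h1)]
    refine indicator_apply_nonneg fun ht => ?_
    have ht2 : t < v₂ * w := ht
    have hwpos : 0 < w := by
      rcases hw.eq_or_lt with rfl | h
      · simp at h1 ht2; linarith
      · exact h
    have htpos : 0 < t := (mul_pos hv₁ hwpos).trans_le (not_lt.1 h1)
    exact mul_nonneg (hpos t htpos).le (Real.exp_pos _).le

/-- Lemma 6 (normal case): for a convex, even, strictly bowl-shaped loss, the solutions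
`z_m(y)` of `∫₀^∞∫_{-∞}^{vy} ρ'(u + z_m(y)v) v^m e^{-(u²+v²)/2} du dv = 0` with
`y + z_m(y) ≥ 0` are nonincreasing in `m`; equivalently the generalized Bayes functions
`g_{π_l}(y) = z_{n+l}(y)` of the normal model are nonincreasing in `l`. -/
theorem stmt11
    (ρ ρd : ℝ → ℝ)
    (hρ0 : ρ 0 = 0) (hρ_nonneg : ∀ t, 0 ≤ ρ t)
    (hρd_neg : ∀ t < (0 : ℝ), ρd t < 0) (hρd_pos : ∀ t > (0 : ℝ), 0 < ρd t)
    (hρ_ftc : ∀ a b : ℝ, ρ b - ρ a = ∫ t in a..b, ρd t)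
    (hρ_convex : Monotone ρd)   -- convexity of ρ: ρ' nondecreasing
    (hρ_even : ∀ t : ℝ, ρ (-t) = ρ t)  -- ρ even, so c₀ = 0
    (z : ℝ → ℝ → ℝ)
    -- z_m(y) solves the defining equation, with y + z_m(y) ≥ 0
    (hz_eq : ∀ m > (0 : ℝ), ∀ y : ℝ,
      (∫ v in Ioi (0 : ℝ), ∫ u in Iio (v * y),
        ρd (u + z m y * v) * v ^ m * Real.exp (-(u ^ 2 + v ^ 2) / 2)) = 0)
    (hz_pos : ∀ m > (0 : ℝ), ∀ y : ℝ, 0 ≤ y + z m y)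
    -- and is the unique such real number
    (hz_unique : ∀ m > (0 : ℝ), ∀ y z' : ℝ,
      ((∫ v in Ioi (0 : ℝ), ∫ u in Iio (v * y),
        ρd (u + z' * v) * v ^ m * Real.exp (-(u ^ 2 + v ^ 2) / 2)) = 0 ∧ 0 ≤ y + z') →
      z' = z m y)
    -- all integrals converge absolutely
    (h_int : ∀ m > (0 : ℝ), ∀ y c : ℝ, IntegrableOn
      (fun pr : ℝ × ℝ =>
        ρd (pr.1 + c * pr.2) * pr.2 ^ m * Real.exp (-(pr.1 ^ 2 + pr.2 ^ 2) / 2))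
      {pr : ℝ × ℝ | 0 < pr.2 ∧ pr.1 < pr.2 * y})
    -- differentiation under the integral sign with respect to m is valid
    (h_diff : ∀ y c : ℝ, ∀ m > (0 : ℝ), HasDerivAt
      (fun m' : ℝ => ∫ v in Ioi (0 : ℝ), ∫ u in Iio (v * y),
        ρd (u + c * v) * v ^ m' * Real.exp (-(u ^ 2 + v ^ 2) / 2))
      (∫ v in Ioi (0 : ℝ), ∫ u in Iio (v * y),
        ρd (u + c * v) * (Real.log v * v ^ m) * Real.exp (-(u ^ 2 + v ^ 2) / 2)) m) :
    ∀ y : ℝ, AntitoneOn (fun m => z m y) (Ioi 0) := by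
  intro y m₁ hm₁ m₂ hm₂ hm
  have inner_eq : ∀ m c v : ℝ, (∫ u in Iio (v * y),
      ρd (u + c * v) * v ^ m * Real.exp (-(u ^ 2 + v ^ 2) / 2)) =
      v ^ m * Real.exp (-v ^ 2 / 2) * ∫ u in Iio (v * y), ρd (u + c * v) * Real.exp (-u ^ 2 / 2) := by
    intro m c v
    rw [← integral_const_mul]
    congr 1
    funext u
    rw [show -(u ^ 2 + v ^ 2) / 2 = -v ^ 2 / 2 + -u ^ 2 / 2 by ring, Real.exp_add]
    ring
  have outer_int : ∀ m > (0 : ℝ), ∀ c : ℝ, IntegrableOn (fun v => v ^ m * Real.exp (-v ^ 2 / 2) *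
      ∫ u in Iio (v * y), ρd (u + c * v) * Real.exp (-u ^ 2 / 2)) (Ioi 0) := by
    intro m hm c
    have h := (integrableOn_sector_slices (h_int m hm y c)).1
    simpa only [inner_eq] using h
  have inner_int : ∀ c : ℝ, ∀ᵐ v ∂volume.restrict (Ioi (0 : ℝ)),
      IntegrableOn (fun u => ρd (u + c * v) * Real.exp (-u ^ 2 / 2)) (Iio (v * y)) := by
    intro c
    filter_upwards [(integrableOn_sector_slices (h_int 1 one_pos y c)).2,
      ae_restrict_mem measurableSet_Ioi] with v hv hv0
    have hv0' : 0 < v := hv0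
    refine (hv.const_mul (v * Real.exp (-v ^ 2 / 2))⁻¹).congr (.of_forall fun u => ?_)
    have he := (Real.exp_pos (-v ^ 2 / 2)).ne'
    simp only [Real.rpow_one]
    rw [show -(u ^ 2 + v ^ 2) / 2 = -v ^ 2 / 2 + -u ^ 2 / 2 by ring, Real.exp_add]
    field_simp
  have outer_mono : ∀ m > (0 : ℝ), ∀ c c' : ℝ, c ≤ c' →
      (∫ v in Ioi (0 : ℝ), ∫ u in Iio (v * y),
        ρd (u + c * v) * v ^ m * Real.exp (-(u ^ 2 + v ^ 2) / 2)) ≤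
      ∫ v in Ioi (0 : ℝ), ∫ u in Iio (v * y),
        ρd (u + c' * v) * v ^ m * Real.exp (-(u ^ 2 + v ^ 2) / 2) := by
    intro m hm c c' hcc
    simp only [inner_eq]
    refine integral_mono_ae (outer_int m hm c) (outer_int m hm c') ?_
    filter_upwards [inner_int c, inner_int c', ae_restrict_mem measurableSet_Ioi] with v h h' hv0
    have hv0' : 0 < v := hv0
    refine mul_le_mul_of_nonneg_left (integral_mono h h' fun u => ?_) (by positivity)
    refine mul_le_mul_of_nonneg_right (hρ_convex ?_) (Real.exp_pos _).le
    linarith [mul_le_mul_of_nonneg_right hcc hv0'.le]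
  have hodd := ae_odd_of_even_primitive hρ_convex hρ_ftc hρ_even
  have hz_nonneg : 0 ≤ z m₁ y := by
    by_contra! hlt
    have hy : 0 ≤ y := by linarith [hz_pos m₁ hm₁ y]
    have hge := outer_mono m₁ hm₁ _ 0 hlt.le
    rw [hz_eq m₁ hm₁ y] at hge
    have hle : (∫ v in Ioi (0 : ℝ), ∫ u in Iio (v * y),
        ρd (u + 0 * v) * v ^ m₁ * Real.exp (-(u ^ 2 + v ^ 2) / 2)) ≤ 0 := by
      simp only [inner_eq]
      refine integral_nonpos_of_ae ?_
      filter_upwards [inner_int 0, ae_restrict_mem measurableSet_Ioi] with v h hv0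
      have hv0' : 0 < v := hv0
      refine mul_nonpos_of_nonneg_of_nonpos (by positivity)
        (setIntegral_Iio_nonpos_of_ae_odd (by positivity) ?_ ?_ h)
      · filter_upwards [hodd] with t ht
        simp [ht]
      · intro t ht
        exact mul_nonpos_of_nonpos_of_nonneg (hρd_neg _ (by simpa using ht)).le (Real.exp_pos _).le
    have := hz_unique m₁ hm₁ y 0 ⟨le_antisymm hle hge, by simpa using hy⟩
    linarith
  have tilt : 0 ≤ ∫ v in Ioi (0 : ℝ), ∫ u in Iio (v * y),
      ρd (u + z m₁ y * v) * v ^ m₂ * Real.exp (-(u ^ 2 + v ^ 2) / 2) := by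
    set c := z m₁ y with hc
    have hmul : ∀ m v : ℝ, (∫ u in Iio (v * y),
        ρd (u + c * v) * v ^ m * Real.exp (-(u ^ 2 + v ^ 2) / 2)) =
        v ^ m * Real.exp (-v ^ 2 / 2) * Real.exp (-(c * v) ^ 2 / 2) *
          ∫ t, tiltedLoss ρd (y + c) c v t := by
      intro m v
      rw [inner_eq, setIntegral_eq_integral_tiltedLoss, mul_assoc, mul_assoc, mul_assoc]
    have hpow : ∀ v ∈ Ioi (0 : ℝ), (∫ u in Iio (v * y),
        ρd (u + c * v) * v ^ m₂ * Real.exp (-(u ^ 2 + v ^ 2) / 2)) =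
        v ^ (m₂ - m₁) * (v ^ m₁ * Real.exp (-v ^ 2 / 2) * Real.exp (-(c * v) ^ 2 / 2) *
          ∫ t, tiltedLoss ρd (y + c) c v t) := by
      intro v hv
      rw [hmul, show v ^ m₂ = v ^ (m₂ - m₁) * v ^ m₁ by
        rw [← Real.rpow_add hv, sub_add_cancel]]
      ring
    rw [setIntegral_congr_fun measurableSet_Ioi hpow]
    refine setIntegral_rpow_mul_nonneg (sub_nonneg.2 hm)
      (V := {v | Integrable (tiltedLoss ρd (y + c) c v) volume})
      ((inner_int c).mono fun v hv => integrable_tiltedLoss hv) ?_ ?_ ?_ ?_ ?_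
    · intro v₁ h₁ v₂ h₂ h₁₂
      exact integral_mono h₁.1 h₂.1
        (tiltedLoss_mono hρd_neg hρd_pos (hz_pos m₁ hm₁ y) hz_nonneg h₁.2 h₁₂)
    · intro v hv
      have := Real.rpow_pos_of_pos hv m₁
      positivity
    · have h := (integrableOn_sector_slices (h_int m₁ hm₁ y c)).1
      simpa only [hmul] using h
    · exact (integrableOn_sector_slices (h_int m₂ hm₂ y c)).1.congr_fun hpow measurableSet_Ioi
    · have h := hz_eq m₁ hm₁ y
      simpa only [← hc, hmul] using h
  change z m₂ y ≤ z m₁ y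
  by_contra! hlt
  have hle := outer_mono m₂ hm₂ _ _ hlt.le
  rw [hz_eq m₂ hm₂ y] at hle
  have := hz_unique m₂ hm₂ y _ ⟨le_antisymm hle tilt, hz_pos m₁ hm₁ y⟩
  linarith
end

section
/- Let f satisfy the model assumption and take ρ(t) = |t|^p with p > 0 (so ρ'(t) = p|t|^{p-1}sgn(t) and c₀ = 0). For m > 0 and y ∈ ℝ, let z_m(y) be the unique real number satisfying ∫₀^∞∫_{-∞}^{vy} ρ'(u + z_m(y)·v) v^m f(u²+v²) du dv = 0 and y + z_m(y) ≥ 0, assuming existence. Then for each fixed y, m ↦ z_m(y) is nonincreasing; equivalently, under scale invariant L^p loss the generalized Bayes functions g_{π_l}(y) = z_{n+l}(y) are nonincreasing in l for every model density f satisfying the assumption. -/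
open MeasureTheory Set

/-- The odd power `|x| ^ (p - 1) * sign x`, the derivative of `|x| ^ p / p`. -/
noncomputable def oddPow (p x : ℝ) : ℝ := |x| ^ (p - 1) * Real.sign x

/-- The Student-type weight `(1 + t ^ 2) ^ (-q)`. -/
noncomputable def studentWeight (q t : ℝ) : ℝ := (1 + t ^ 2) ^ (-q)

/-- The one-dimensional estimating function to which the double integral reduces. -/
noncomputable def estimating (p q y c : ℝ) : ℝ :=
  ∫ t in Iio y, oddPow p (t + c) * studentWeight q t

lemma measurable_realSign : Measurable Real.sign := by
  unfold Real.sign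
  exact Measurable.ite measurableSet_Iio measurable_const
    (Measurable.ite measurableSet_Ioi measurable_const measurable_const)

lemma measurable_oddPow (p : ℝ) : Measurable (oddPow p) := by
  unfold oddPow
  exact (by fun_prop : Measurable fun x : ℝ => |x| ^ (p - 1)).mul measurable_realSign

lemma continuous_studentWeight (q : ℝ) : Continuous (studentWeight q) := by
  unfold studentWeight
  exact Continuous.rpow_const (by fun_prop) fun t => Or.inl (by positivity)

lemma measurable_studentWeight (q : ℝ) : Measurable (studentWeight q) :=
  (continuous_studentWeight q).measurable

lemma oddPow_of_pos (p : ℝ) {x : ℝ} (hx : 0 < x) : oddPow p x = x ^ (p - 1) := by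
  rw [oddPow, Real.sign_of_pos hx, abs_of_pos hx, mul_one]

lemma oddPow_neg (p x : ℝ) : oddPow p (-x) = -oddPow p x := by
  rw [oddPow, oddPow, Real.sign_neg, abs_neg, mul_neg]

lemma oddPow_zero (p : ℝ) : oddPow p 0 = 0 := by
  rw [oddPow, Real.sign_zero, mul_zero]

lemma oddPow_pos (p : ℝ) {x : ℝ} (hx : 0 < x) : 0 < oddPow p x := by
  rw [oddPow_of_pos p hx]
  positivity

lemma oddPow_nonneg (p : ℝ) {x : ℝ} (hx : 0 ≤ x) : 0 ≤ oddPow p x := by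
  rcases hx.eq_or_lt with rfl | hx
  · exact (oddPow_zero p).ge
  · exact (oddPow_pos p hx).le

lemma oddPow_nonpos (p : ℝ) {x : ℝ} (hx : x ≤ 0) : oddPow p x ≤ 0 := by
  have h := oddPow_nonneg p (neg_nonneg.2 hx)
  rw [oddPow_neg] at h
  linarith

lemma oddPow_mul (p : ℝ) {v : ℝ} (hv : 0 < v) (x : ℝ) :
    oddPow p (v * x) = v ^ (p - 1) * oddPow p x := by
  have hs : Real.sign (v * x) = Real.sign x := by
    rcases lt_trichotomy x 0 with hx | rfl | hx
    · rw [Real.sign_of_neg hx, Real.sign_of_neg (mul_neg_of_pos_of_neg hv hx)]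
    · rw [mul_zero]
    · rw [Real.sign_of_pos hx, Real.sign_of_pos (mul_pos hv hx)]
  rw [oddPow, oddPow, hs, abs_mul, abs_of_pos hv, Real.mul_rpow hv.le (abs_nonneg x), mul_assoc]

lemma abs_oddPow_le (p x : ℝ) : |oddPow p x| ≤ |x| ^ (p - 1) := by
  have h : |Real.sign x| ≤ 1 := by
    rcases Real.sign_apply_eq x with h | h | h <;> simp [h]
  rw [oddPow, abs_mul, abs_of_nonneg (by positivity : 0 ≤ |x| ^ (p - 1))]
  exact mul_le_of_le_one_right (by positivity) h

lemma studentWeight_pos (q t : ℝ) : 0 < studentWeight q t := by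
  unfold studentWeight
  positivity

lemma studentWeight_neg (q t : ℝ) : studentWeight q (-t) = studentWeight q t := by
  rw [studentWeight, studentWeight, neg_sq]

lemma studentWeight_le_of_sq_le {q : ℝ} (hq : 0 ≤ q) {s t : ℝ} (h : s ^ 2 ≤ t ^ 2) :
    studentWeight q t ≤ studentWeight q s :=
  Real.rpow_le_rpow_of_nonpos (by positivity) (by linarith) (by linarith)

lemma studentWeight_add (q r t : ℝ) :
    studentWeight (q + r) t = studentWeight q t * studentWeight r t := by
  rw [studentWeight, neg_add, Real.rpow_add (by positivity)]
  rfl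

lemma studentWeight_sub_le {q : ℝ} (hq : 0 ≤ q) {c C : ℝ} (hc : c ^ 2 ≤ C) (x : ℝ) :
    studentWeight q (x - c) ≤ (2 * (1 + C)) ^ q * studentWeight q x := by
  have hC : 0 ≤ C := (sq_nonneg c).trans hc
  have h : (1 + x ^ 2) ≤ 2 * (1 + C) * (1 + (x - c) ^ 2) := by
    nlinarith [sq_nonneg (x - 2 * c), mul_nonneg hC (sq_nonneg (x - c))]
  have h2 := Real.rpow_le_rpow (by positivity) h hq
  rw [Real.mul_rpow (by positivity) (by positivity)] at h2
  rw [studentWeight, studentWeight, Real.rpow_neg (by positivity), Real.rpow_neg (by positivity),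
    ← div_eq_mul_inv, inv_eq_one_div, div_le_div_iff₀ (by positivity) (by positivity)]
  linarith

lemma integrable_abs_rpow_mul_studentWeight {p q : ℝ} (hp : 0 < p) (hpq : p < 2 * q) :
    Integrable fun x : ℝ => |x| ^ (p - 1) * studentWeight q x := by
  have hm : Measurable fun x : ℝ => |x| ^ (p - 1) * studentWeight q x :=
    (by fun_prop : Measurable fun x : ℝ => |x| ^ (p - 1)).mul (measurable_studentWeight q)
  have hnear : IntegrableOn (fun x : ℝ => |x| ^ (p - 1) * studentWeight q x) (Ioc 0 1) := by
    have h := (intervalIntegral.intervalIntegrable_rpow' (a := 0) (b := 1)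
      (by linarith : -1 < p - 1)).1
    refine Integrable.mono' h hm.aestronglyMeasurable ?_
    filter_upwards [ae_restrict_mem measurableSet_Ioc] with x hx
    have h1 : studentWeight q x ≤ 1 := by
      refine (studentWeight_le_of_sq_le (by linarith) (s := 0) (by nlinarith [hx.1])).trans ?_
      simp [studentWeight]
    rw [Real.norm_of_nonneg (mul_nonneg (by positivity) (studentWeight_pos q x).le),
      abs_of_pos hx.1]
    exact mul_le_of_le_one_right (Real.rpow_nonneg hx.1.le _) h1
  have hfar : IntegrableOn (fun x : ℝ => |x| ^ (p - 1) * studentWeight q x) (Ioi 1) := by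
    have h := integrableOn_Ioi_rpow_of_lt (a := p - 1 - 2 * q) (by linarith) zero_lt_one
    refine Integrable.mono' h hm.aestronglyMeasurable ?_
    filter_upwards [ae_restrict_mem measurableSet_Ioi] with x hx
    have hx0 : 0 < x := zero_lt_one.trans hx
    have h1 : studentWeight q x ≤ x ^ (-(2 * q)) := by
      have : x ^ (-(2 * q)) = (x ^ 2) ^ (-q) := by
        rw [← Real.rpow_natCast, ← Real.rpow_mul hx0.le]
        congr 1
        push_cast
        ring
      rw [this]
      exact Real.rpow_le_rpow_of_nonpos (by positivity) (by linarith) (by linarith)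
    rw [Real.norm_of_nonneg (mul_nonneg (by positivity) (studentWeight_pos q x).le),
      abs_of_pos hx0, sub_eq_add_neg (p - 1), Real.rpow_add hx0]
    gcongr
  have hpos : IntegrableOn (fun x : ℝ => |x| ^ (p - 1) * studentWeight q x) (Ioi 0) := by
    rw [← Ioc_union_Ioi_eq_Ioi zero_le_one]
    exact hnear.union hfar
  have hneg : IntegrableOn (fun x : ℝ => |x| ^ (p - 1) * studentWeight q x) (Iio 0) := by
    have h := IntegrableOn.comp_neg_Iio (c := (0 : ℝ)) (by rwa [neg_zero])
    simpa only [abs_neg, studentWeight_neg] using h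
  rw [← integrableOn_univ, ← Iic_union_Ioi (a := (0 : ℝ))]
  exact (integrableOn_Iic_iff_integrableOn_Iio enorm_ne_top |>.2 hneg).union hpos

lemma integrable_oddPow_mul_studentWeight {p q : ℝ} (hp : 0 < p) (hpq : p < 2 * q) (c : ℝ) :
    Integrable fun t : ℝ => oddPow p (t + c) * studentWeight q t := by
  have h : Integrable fun x : ℝ => oddPow p x * studentWeight q (x - c) := by
    refine Integrable.mono'
      ((integrable_abs_rpow_mul_studentWeight hp hpq).const_mul ((2 * (1 + c ^ 2)) ^ q))
      ((measurable_oddPow p).mul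
        ((measurable_studentWeight q).comp (by fun_prop))).aestronglyMeasurable
      (Filter.Eventually.of_forall fun x => ?_)
    rw [Real.norm_eq_abs, abs_mul, abs_of_pos (studentWeight_pos _ _), mul_left_comm]
    exact mul_le_mul (abs_oddPow_le p x) (studentWeight_sub_le (by linarith) le_rfl x)
      (studentWeight_pos _ _).le (by positivity)
  simpa using h.comp_add_right c

lemma estimating_eq_integral_indicator (p q y c : ℝ) :
    estimating p q y c =
      ∫ t, (Iio y).indicator (fun t => oddPow p (t + c)) t * studentWeight q t := by
  rw [estimating, ← integral_indicator measurableSet_Iio]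
  congr 1 with t
  by_cases h : t ∈ Iio y <;> simp [h]

lemma integrable_indicator_oddPow_mul_studentWeight {p q : ℝ} (hp : 0 < p) (hpq : p < 2 * q)
    (y c : ℝ) :
    Integrable fun t : ℝ =>
      (Iio y).indicator (fun t => oddPow p (t + c)) t * studentWeight q t := by
  refine ((integrable_oddPow_mul_studentWeight hp hpq c).indicator
    (measurableSet_Iio (a := y))).congr (Filter.Eventually.of_forall fun t => ?_)
  by_cases h : t ∈ Iio y <;> simp [h]

lemma estimating_eq_integral_sub (p q y c : ℝ) :
    estimating p q y c =
      ∫ x, (Iio (y + c)).indicator (oddPow p) x * studentWeight q (x - c) := by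
  rw [estimating_eq_integral_indicator, ← integral_sub_right_eq_self _ c]
  congr 1 with x
  simp [indicator, sub_lt_iff_lt_add]

lemma continuous_estimating {p q : ℝ} (hp : 0 < p) (hpq : p < 2 * q) (y : ℝ) :
    Continuous (estimating p q y) := by
  rw [funext (estimating_eq_integral_sub p q y)]
  refine continuous_iff_continuousAt.2 fun c₀ => ?_
  refine continuousAt_of_dominated
    (bound := fun x => (2 * (1 + (|c₀| + 1) ^ 2)) ^ q * (|x| ^ (p - 1) * studentWeight q x))
    (Filter.Eventually.of_forall fun c => ?_) ?_
    ((integrable_abs_rpow_mul_studentWeight hp hpq).const_mul _) ?_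
  · exact (((measurable_oddPow p).indicator measurableSet_Iio).mul
      ((measurable_studentWeight q).comp (by fun_prop))).aestronglyMeasurable
  · filter_upwards [Metric.ball_mem_nhds c₀ one_pos] with c hc
    refine Filter.Eventually.of_forall fun x => ?_
    have hc' : c ^ 2 ≤ (|c₀| + 1) ^ 2 := by
      rw [Metric.mem_ball, Real.dist_eq] at hc
      have := abs_sub_abs_le_abs_sub c c₀
      rw [← sq_abs c]
      gcongr
      linarith
    rw [Real.norm_eq_abs, abs_mul, abs_of_pos (studentWeight_pos _ _), mul_left_comm]
    refine mul_le_mul ?_ (studentWeight_sub_le (by linarith) hc' x)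
      (studentWeight_pos _ _).le (by positivity)
    by_cases h : x ∈ Iio (y + c)
    · rw [indicator_of_mem h]
      exact abs_oddPow_le p x
    · rw [indicator_of_notMem h, abs_zero]
      positivity
  · filter_upwards [compl_mem_ae_iff.2 (measure_singleton (μ := volume) (y + c₀))] with x hx
    have hw : ContinuousAt (fun c => studentWeight q (x - c)) c₀ :=
      ((continuous_studentWeight q).comp (by fun_prop)).continuousAt
    refine ContinuousAt.mul ?_ hw
    rcases lt_or_gt_of_ne (show x ≠ y + c₀ from hx) with h | h
    · refine (continuousAt_const (y := oddPow p x)).congr ?_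
      filter_upwards [lt_mem_nhds (show x - y < c₀ by linarith)] with c hc
      rw [indicator_of_mem (mem_Iio.2 (by linarith : x < y + c))]
    · refine (continuousAt_const (y := (0 : ℝ))).congr ?_
      filter_upwards [gt_mem_nhds (show c₀ < x - y by linarith)] with c hc
      rw [indicator_of_notMem (notMem_Iio.2 (by linarith : y + c ≤ x))]

lemma two_mul_integral_eq_integral_add_neg {g : ℝ → ℝ} (hg : Integrable g) :
    2 * ∫ x, g x = ∫ x, (g x + g (-x)) := by
  rw [integral_add hg hg.comp_neg, integral_neg_eq_self]
  ring

lemma estimating_neg_nonpos (p q y : ℝ) : estimating p q y (-y) ≤ 0 := by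
  refine setIntegral_nonpos measurableSet_Iio fun t ht => ?_
  exact mul_nonpos_of_nonpos_of_nonneg
    (oddPow_nonpos p (by linarith [show t < y from ht])) (studentWeight_pos q t).le

lemma estimating_neg_of_nonpos {p q : ℝ} (hp : 0 < p) (hpq : p < 2 * q) {y c : ℝ}
    (hc : c ≤ 0) (hyc : 0 ≤ y + c) : estimating p q y c < 0 := by
  set g : ℝ → ℝ := fun x => (Iio (y + c)).indicator (oddPow p) x * studentWeight q (x - c) with hg
  have hgi : Integrable g := by
    refine ((integrable_indicator_oddPow_mul_studentWeight hp hpq y c).comp_sub_right c).congr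
      (Filter.Eventually.of_forall fun x => ?_)
    simp [hg, indicator, sub_lt_iff_lt_add]
  have hpos : ∀ x, 0 < x → g x + g (-x) ≤ 0 ∧ (y + c < x → g x + g (-x) < 0) := by
    intro x hx
    have hneg : g (-x) = -(oddPow p x * studentWeight q (-x - c)) := by
      rw [hg]
      dsimp only
      rw [indicator_of_mem (mem_Iio.2 (by linarith : -x < y + c)), oddPow_neg, neg_mul]
    have hw : studentWeight q (x - c) ≤ studentWeight q (-x - c) :=
      studentWeight_le_of_sq_le (by linarith) (by nlinarith)
    have ho := oddPow_pos p hx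
    have hw' := mul_pos ho (studentWeight_pos q (-x - c))
    rw [hneg]
    by_cases h : x < y + c
    · have hgx : g x = oddPow p x * studentWeight q (x - c) := by
        rw [hg]
        dsimp only
        rw [indicator_of_mem (show x ∈ Iio (y + c) from h)]
      rw [hgx]
      exact ⟨by nlinarith, fun h' => absurd h h'.not_gt⟩
    · have hgx : g x = 0 := by
        rw [hg]
        dsimp only
        rw [indicator_of_notMem (show x ∉ Iio (y + c) from h), zero_mul]
      rw [hgx]
      exact ⟨by linarith, fun _ => by linarith⟩
  have hnonneg : ∀ x, 0 ≤ -(g x + g (-x)) := by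
    intro x
    rcases lt_trichotomy x 0 with hx | rfl | hx
    · have := (hpos (-x) (by linarith)).1
      rw [neg_neg] at this
      linarith
    · have : g 0 = 0 := by simp [hg, indicator, oddPow_zero]
      simp [this]
    · linarith [(hpos x hx).1]
  have hint : 0 < ∫ x, -(g x + g (-x)) := by
    rw [integral_pos_iff_support_of_nonneg_ae (Filter.Eventually.of_forall hnonneg)
      (hgi.add hgi.comp_neg).neg]
    refine lt_of_lt_of_le ?_ (measure_mono (s := Ioi (y + c)) fun x hx => ?_)
    · simp
    · have hx' : y + c < x := hx
      have := (hpos x (by linarith)).2 hx'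
      exact (by linarith : 0 < -(g x + g (-x))).ne'
  rw [integral_neg, ← two_mul_integral_eq_integral_add_neg hgi] at hint
  rw [estimating_eq_integral_sub]
  linarith

/-- Folding the truncated odd power around the origin produces a function of `r > 0` with a
single sign change, from positive to negative. -/
lemma exists_sign_change_fold (p : ℝ) {y c : ℝ} (hc : 0 < c) (hyc : 0 ≤ y + c) :
    ∃ r₀ : ℝ, 0 < r₀ ∧ ∀ r, 0 ≤ r →
      (r < r₀ → 0 ≤ (Iio y).indicator (fun t => oddPow p (t + c)) r
        + (Iio y).indicator (fun t => oddPow p (t + c)) (-r)) ∧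
      (r₀ < r → (Iio y).indicator (fun t => oddPow p (t + c)) r
        + (Iio y).indicator (fun t => oddPow p (t + c)) (-r) ≤ 0) := by
  have hinner : ∀ r, 0 ≤ r → r ≤ c → 0 ≤ (Iio y).indicator (fun t => oddPow p (t + c)) r
        + (Iio y).indicator (fun t => oddPow p (t + c)) (-r) := by
    intro r hr hrc
    exact add_nonneg (indicator_apply_nonneg fun _ => oddPow_nonneg p (by linarith))
      (indicator_apply_nonneg fun _ => oddPow_nonneg p (by linarith))
  have hreflect : ∀ r, c < r → (Iio y).indicator (fun t => oddPow p (t + c)) (-r)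
      = -(r - c) ^ (p - 1) := by
    intro r hr
    rw [indicator_of_mem (mem_Iio.2 (by linarith : -r < y)), show -r + c = -(r - c) by ring, oddPow_neg,
      oddPow_of_pos p (by linarith)]
  have hdirect : ∀ r, c < r → r < y → (Iio y).indicator (fun t => oddPow p (t + c)) r
      = (r + c) ^ (p - 1) := by
    intro r hr hry
    rw [indicator_of_mem (show r ∈ Iio y from hry), oddPow_of_pos p (by linarith)]
  have houter : ∀ r, c < r → y ≤ r → (Iio y).indicator (fun t => oddPow p (t + c)) r
        + (Iio y).indicator (fun t => oddPow p (t + c)) (-r) ≤ 0 := by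
    intro r hr hry
    rw [indicator_of_notMem (show r ∉ Iio y from hry.not_gt), hreflect r hr, zero_add]
    exact neg_nonpos.2 (Real.rpow_nonneg (by linarith) _)
  rcases le_total 1 p with hp | hp
  · refine ⟨max c y, lt_max_of_lt_left hc, fun r hr => ⟨fun h => ?_, fun h => ?_⟩⟩
    · rcases le_or_gt r c with hrc | hrc
      · exact hinner r hr hrc
      · have hry : r < y := (lt_max_iff.1 h).resolve_left hrc.not_gt
        rw [hdirect r hrc hry, hreflect r hrc]
        have := Real.rpow_le_rpow (by linarith : 0 ≤ r - c) (by linarith : r - c ≤ r + c)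
          (by linarith : 0 ≤ p - 1)
        linarith
    · exact houter r (max_lt_iff.1 h).1 (max_lt_iff.1 h).2.le
  · refine ⟨c, hc, fun r hr => ⟨fun h => hinner r hr h.le, fun h => ?_⟩⟩
    rcases lt_or_ge r y with hry | hry
    · rw [hdirect r h hry, hreflect r h]
      have := Real.rpow_le_rpow_of_nonpos (by linarith : 0 < r - c)
        (by linarith : r - c ≤ r + c) (by linarith : p - 1 ≤ 0)
      linarith
    · exact houter r h hry

lemma estimating_nonneg_of_eq_zero {p q q' : ℝ} (hp : 0 < p) (hpq : p < 2 * q) (hqq' : q ≤ q')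
    {y c : ℝ} (hc : 0 < c) (hyc : 0 ≤ y + c) (h : estimating p q y c = 0) :
    0 ≤ estimating p q' y c := by
  obtain ⟨r₀, hr₀, hsign⟩ := exists_sign_change_fold p hc hyc
  set ψ : ℝ → ℝ := (Iio y).indicator fun t => oddPow p (t + c) with hψ
  set κ := studentWeight (q' - q) r₀ with hκ
  have hi := integrable_indicator_oddPow_mul_studentWeight hp hpq y c
  have hi' := integrable_indicator_oddPow_mul_studentWeight hp (by linarith : p < 2 * q') y c
  have hfactor : ∀ t, studentWeight q' t - κ * studentWeight q t
      = studentWeight q t * (studentWeight (q' - q) t - κ) := by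
    intro t
    rw [show q' = q + (q' - q) by ring, studentWeight_add, add_sub_cancel_left]
    ring
  have hpos : ∀ r, 0 ≤ r → 0 ≤ (ψ r + ψ (-r)) * (studentWeight q' r - κ * studentWeight q r) := by
    intro r hr
    rw [hfactor]
    have hw := (studentWeight_pos q r).le
    rcases lt_trichotomy r r₀ with hlt | heq | hlt
    · have := studentWeight_le_of_sq_le (sub_nonneg.2 hqq') (by gcongr : r ^ 2 ≤ r₀ ^ 2)
      exact mul_nonneg ((hsign r hr).1 hlt) (mul_nonneg hw (sub_nonneg.2 this))
    · simp [heq, hκ]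
    · have := studentWeight_le_of_sq_le (sub_nonneg.2 hqq') (by gcongr : r₀ ^ 2 ≤ r ^ 2)
      exact mul_nonneg_of_nonpos_of_nonpos ((hsign r hr).2 hlt)
        (mul_nonpos_of_nonneg_of_nonpos hw (sub_nonpos.2 this))
  set g : ℝ → ℝ := fun t => ψ t * studentWeight q' t - κ * (ψ t * studentWeight q t) with hg
  have hgi : Integrable g := hi'.sub (hi.const_mul κ)
  have hgint : ∫ t, g t = estimating p q' y c := by
    rw [integral_sub hi' (hi.const_mul κ), integral_const_mul, ← estimating_eq_integral_indicator,
      ← estimating_eq_integral_indicator, h, mul_zero, sub_zero]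
  have hnonneg : ∀ t, 0 ≤ g t + g (-t) := by
    intro t
    have heq : g t + g (-t)
        = (ψ t + ψ (-t)) * (studentWeight q' t - κ * studentWeight q t) := by
      simp only [hg, studentWeight_neg]
      ring
    rw [heq]
    rcases le_total 0 t with ht | ht
    · exact hpos t ht
    · have := hpos (-t) (by linarith)
      simpa only [studentWeight_neg, neg_neg, add_comm (ψ (-t))] using this
  have := two_mul_integral_eq_integral_add_neg hgi
  have h0 : 0 ≤ ∫ t, (g t + g (-t)) := integral_nonneg hnonneg
  linarith

/-- Comparison of the zeros of two estimating functions. -/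
lemma exists_zero_le_of_estimating_eq_zero {p q q' : ℝ} (hp : 0 < p) (hpq : p < 2 * q)
    (hqq' : q ≤ q') {y c : ℝ} (hyc : 0 ≤ y + c) (h : estimating p q y c = 0) :
    ∃ c' ≤ c, 0 ≤ y + c' ∧ estimating p q' y c' = 0 := by
  have hc : 0 < c := by
    by_contra hc
    exact (estimating_neg_of_nonpos hp hpq (not_lt.1 hc) hyc).ne h
  have hivt := intermediate_value_Icc (by linarith : -y ≤ c)
    (continuous_estimating hp (by linarith : p < 2 * q') y).continuousOn
  obtain ⟨c', hc', hzero⟩ := hivt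
    ⟨estimating_neg_nonpos p q' y, estimating_nonneg_of_eq_zero hp hpq hqq' hc hyc h⟩
  exact ⟨c', hc'.2, by linarith [hc'.1], hzero⟩

lemma integral_abs_mul_comp_mul_left (g : ℝ → ℝ) {v : ℝ} (hv : v ≠ 0) :
    ∫ t, |v| * g (v * t) = ∫ u, g u := by
  rw [integral_const_mul, Measure.integral_comp_mul_left, smul_eq_mul, abs_inv, ← mul_assoc,
    mul_inv_cancel₀ (abs_ne_zero.2 hv), one_mul]

lemma ae_ne_zero : ∀ᵐ v : ℝ, v ≠ 0 :=
  compl_mem_ae_iff.2 (measure_singleton (μ := volume) (0 : ℝ))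

lemma integrable_abs_mul_comp_shear {F : ℝ × ℝ → ℝ} (hm : Measurable F) (hF : Integrable F) :
    Integrable fun x : ℝ × ℝ => |x.1| * F (x.1 * x.2, x.1) := by
  have hm' : Measurable fun x : ℝ × ℝ => |x.1| * F (x.1 * x.2, x.1) :=
    (by fun_prop : Measurable fun x : ℝ × ℝ => |x.1|).mul (hm.comp (by fun_prop))
  obtain ⟨hsec, hnorm⟩ := (integrable_prod_iff' hm.aestronglyMeasurable).1 hF
  refine (integrable_prod_iff hm'.aestronglyMeasurable).2 ⟨?_, hnorm.congr ?_⟩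
  · filter_upwards [hsec, ae_ne_zero] with v hv hv0
    exact ((integrable_comp_mul_left_iff (fun u => F (u, v)) hv0).2 hv).const_mul _
  · filter_upwards [ae_ne_zero] with v hv0
    rw [← integral_abs_mul_comp_mul_left _ hv0]
    congr 1 with t
    rw [norm_mul, Real.norm_eq_abs |v|, abs_abs]

lemma integral_comp_shear {F : ℝ × ℝ → ℝ} (hm : Measurable F) (hF : Integrable F) :
    ∫ v, ∫ u, F (u, v) = ∫ t, ∫ v, |v| * F (v * t, v) := by
  rw [← integral_integral_swap (f := fun v t => |v| * F (v * t, v))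
    (integrable_abs_mul_comp_shear hm hF)]
  refine integral_congr_ae ?_
  filter_upwards [ae_ne_zero] with v hv0
  rw [integral_abs_mul_comp_mul_left (fun u => F (u, v)) hv0]

lemma sqrt_one_add_sq_rpow (a t : ℝ) :
    (√(1 + t ^ 2) ^ a)⁻¹ * (√(1 + t ^ 2))⁻¹ = studentWeight ((a + 1) / 2) t := by
  have h : 0 < 1 + t ^ 2 := by positivity
  rw [← Real.rpow_neg (Real.sqrt_nonneg _), ← Real.rpow_neg_one √(1 + t ^ 2),
    ← Real.rpow_add (Real.sqrt_pos.2 h), Real.sqrt_eq_rpow, ← Real.rpow_mul h.le, studentWeight]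
  congr 1
  ring

lemma rpow_mul_comp_sq_eq (f : ℝ → ℝ) (a t : ℝ) {v : ℝ} (hv : 0 < v) :
    v ^ a * f (v ^ 2 * (1 + t ^ 2)) =
      (√(1 + t ^ 2) ^ a)⁻¹ * ((√(1 + t ^ 2) * v) ^ a * f ((√(1 + t ^ 2) * v) ^ 2)) := by
  have h : 0 < 1 + t ^ 2 := by positivity
  have hs : 0 < √(1 + t ^ 2) := Real.sqrt_pos.2 h
  have hsa : √(1 + t ^ 2) ^ a ≠ 0 := (Real.rpow_pos_of_pos hs a).ne'
  rw [Real.mul_rpow hs.le hv.le, mul_pow, Real.sq_sqrt h.le, mul_comm (1 + t ^ 2)]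
  field_simp

lemma integral_rpow_mul_comp_sq (f : ℝ → ℝ) (a t : ℝ) :
    ∫ v in Ioi 0, v ^ a * f (v ^ 2 * (1 + t ^ 2)) =
      studentWeight ((a + 1) / 2) t * ∫ w in Ioi 0, w ^ a * f (w ^ 2) := by
  have hs : 0 < √(1 + t ^ 2) := Real.sqrt_pos.2 (by positivity)
  rw [setIntegral_congr_fun measurableSet_Ioi fun v hv => rpow_mul_comp_sq_eq f a t hv,
    integral_const_mul, integral_comp_mul_left_Ioi (fun w => w ^ a * f (w ^ 2)) 0 hs, mul_zero,
    smul_eq_mul, ← mul_assoc, sqrt_one_add_sq_rpow]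

lemma integrableOn_rpow_mul_comp_sq {f : ℝ → ℝ} {a t : ℝ}
    (h : IntegrableOn (fun v => v ^ a * f (v ^ 2 * (1 + t ^ 2))) (Ioi 0)) :
    IntegrableOn (fun w => w ^ a * f (w ^ 2)) (Ioi 0) := by
  have hs : 0 < √(1 + t ^ 2) := Real.sqrt_pos.2 (by positivity)
  rw [integrableOn_congr_fun
      (fun v (hv : v ∈ Ioi 0) => rpow_mul_comp_sq_eq f a t hv) measurableSet_Ioi,
    IntegrableOn, integrable_const_mul_iff
      (inv_ne_zero (Real.rpow_pos_of_pos hs a).ne').isUnit] at h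
  simpa using (integrableOn_Ioi_comp_mul_left_iff (fun w => w ^ a * f (w ^ 2)) 0 hs).1 h

/-- Under the odd power score the double integral factors into a positive radial constant,
the only place where the density enters, and the one-dimensional estimating function. -/
lemma exists_pos_mul_estimating {p m y c : ℝ} {f : ℝ → ℝ} (hf_pos : ∀ t > 0, 0 < f t)
    (hf : ContinuousOn f (Ioi 0))
    (hint : IntegrableOn
      (fun x : ℝ × ℝ => oddPow p (x.1 + c * x.2) * x.2 ^ m * f (x.1 ^ 2 + x.2 ^ 2))
      {x : ℝ × ℝ | 0 < x.2 ∧ x.1 < x.2 * y}) :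
    ∃ K > 0, (∫ v in Ioi (0 : ℝ), ∫ u in Iio (v * y),
      oddPow p (u + c * v) * v ^ m * f (u ^ 2 + v ^ 2)) =
        K * estimating p ((p + m + 1) / 2) y c := by
  set S : Set (ℝ × ℝ) := {x | 0 < x.2 ∧ x.1 < x.2 * y} with hS
  have hSm : MeasurableSet S :=
    (measurableSet_lt measurable_const measurable_snd).inter
      (measurableSet_lt measurable_fst (by fun_prop))
  set F : ℝ × ℝ → ℝ := S.indicator
    fun x => oddPow p (x.1 + c * x.2) * x.2 ^ m * f (x.1 ^ 2 + x.2 ^ 2) with hF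
  have hFi : Integrable F := (integrable_indicator_iff hSm).2 hint
  have hfm : Measurable ((Ioi 0).indicator f) := by
    classical
    rw [← piecewise_eq_indicator]
    exact hf.measurable_piecewise continuousOn_const measurableSet_Ioi
  have hFm : Measurable F := by
    have heq : F = S.indicator fun x =>
        oddPow p (x.1 + c * x.2) * x.2 ^ m * (Ioi 0).indicator f (x.1 ^ 2 + x.2 ^ 2) := by
      refine indicator_congr fun x hx => ?_
      have hx2 : 0 < x.2 := hx.1
      rw [indicator_of_mem (mem_Ioi.2 (by positivity : 0 < x.1 ^ 2 + x.2 ^ 2))]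
    rw [heq]
    exact ((((measurable_oddPow p).comp (by fun_prop)).mul (by fun_prop)).mul
      (hfm.comp (by fun_prop))).indicator hSm
  have hshear : ∀ t v, |v| * F (v * t, v) = (Iio y).indicator (fun t => oddPow p (t + c)) t *
      (Ioi 0).indicator (fun v => v ^ (p + m) * f (v ^ 2 * (1 + t ^ 2))) v := by
    intro t v
    rcases le_or_gt v 0 with hv | hv
    · rw [hF, indicator_of_notMem (fun h : (v * t, v) ∈ S => hv.not_gt h.1),
        indicator_of_notMem (notMem_Ioi.2 hv), mul_zero, mul_zero]
    rcases lt_or_ge t y with ht | ht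
    · have hmem : (v * t, v) ∈ S := ⟨hv, mul_lt_mul_of_pos_left ht hv⟩
      rw [hF, indicator_of_mem hmem, indicator_of_mem (mem_Ioi.2 hv),
        indicator_of_mem (mem_Iio.2 ht), abs_of_pos hv]
      dsimp only
      rw [show v * t + c * v = v * (t + c) by ring, oddPow_mul p hv,
        show (v * t) ^ 2 + v ^ 2 = v ^ 2 * (1 + t ^ 2) by ring,
        show p + m = 1 + (p - 1) + m by ring, Real.rpow_add hv, Real.rpow_add hv, Real.rpow_one]
      ring
    · rw [hF, indicator_of_notMem (fun h : (v * t, v) ∈ S =>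
          ht.not_gt (lt_of_mul_lt_mul_left h.2 hv.le)),
        indicator_of_notMem (notMem_Iio.2 ht), mul_zero, zero_mul]
  have hradial : IntegrableOn (fun w => w ^ (p + m) * f (w ^ 2)) (Ioi 0) := by
    have hsec := (integrable_abs_mul_comp_shear hFm hFi).prod_left_ae
    obtain ⟨t, ht, hti⟩ : ∃ t ∈ Iio (min y (-c)),
        Integrable fun v : ℝ => |v| * F (v * t, v) := by
      have hfreq : ∃ᶠ t in ae (volume : Measure ℝ), t ∈ Iio (min y (-c)) := by
        rw [frequently_ae_mem_iff]
        simp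
      exact (hfreq.and_eventually hsec).exists
    obtain ⟨hty, htc⟩ := lt_min_iff.1 (mem_Iio.1 ht)
    have hne : oddPow p (t + c) ≠ 0 := by
      have := oddPow_pos p (by linarith : 0 < -(t + c))
      rw [oddPow_neg] at this
      exact (neg_pos.1 this).ne
    simp only [hshear, indicator_of_mem (mem_Iio.2 hty)] at hti
    rw [integrable_const_mul_iff hne.isUnit, integrable_indicator_iff measurableSet_Ioi] at hti
    exact integrableOn_rpow_mul_comp_sq hti
  refine ⟨∫ w in Ioi 0, w ^ (p + m) * f (w ^ 2), ?_, ?_⟩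
  · have hpos : ∀ w ∈ Ioi (0 : ℝ), 0 < w ^ (p + m) * f (w ^ 2) := fun w hw =>
      mul_pos (Real.rpow_pos_of_pos hw _) (hf_pos _ (pow_pos hw 2))
    rw [gt_iff_lt, setIntegral_pos_iff_support_of_nonneg_ae
      (ae_restrict_of_forall_mem measurableSet_Ioi fun w hw => (hpos w hw).le) hradial,
      inter_eq_right.2 fun w hw => Function.mem_support.2 (hpos w hw).ne']
    simp
  · have hleft : (∫ v in Ioi (0 : ℝ), ∫ u in Iio (v * y),
        oddPow p (u + c * v) * v ^ m * f (u ^ 2 + v ^ 2)) = ∫ v, ∫ u, F (u, v) := by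
      rw [← integral_indicator measurableSet_Ioi]
      congr 1 with v
      rcases le_or_gt v 0 with hv | hv
      · rw [indicator_of_notMem (notMem_Ioi.2 hv)]
        symm
        refine integral_eq_zero_of_ae (Filter.Eventually.of_forall fun u => ?_)
        exact indicator_of_notMem (fun h : (u, v) ∈ S => hv.not_gt h.1) _
      · rw [indicator_of_mem (mem_Ioi.2 hv), ← integral_indicator measurableSet_Iio]
        congr 1 with u
        simp [hF, hS, indicator, hv]
    rw [hleft, integral_comp_shear hFm hFi, estimating_eq_integral_indicator,
      ← integral_const_mul]
    congr 1 with t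
    simp only [hshear]
    rw [integral_const_mul, integral_indicator measurableSet_Ioi, integral_rpow_mul_comp_sq]
    ring



/-- Corollary 1: under scale invariant `L^p` loss (`ρ(t) = |t|^p`, `p > 0`,
`ρ'(t) = p|t|^{p-1}sgn(t)`, `c₀ = 0`), for every model density `f` satisfying the model
assumption, the solutions `z_m(y)` of
`∫₀^∞∫_{-∞}^{vy} ρ'(u + z_m(y)v) v^m f(u²+v²) du dv = 0` with `y + z_m(y) ≥ 0` are
nonincreasing in `m`; equivalently the generalized Bayes functions `g_{π_l} = z_{n+l}`
are nonincreasing in `l`. -/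
theorem stmt12
    (p : ℝ) (hp : 0 < p)
    (ρ ρd : ℝ → ℝ)
    (hρ_def : ∀ t : ℝ, ρ t = |t| ^ p)
    (hρd_def : ∀ t : ℝ, ρd t = p * |t| ^ (p - 1) * Real.sign t)
    -- the model assumption on f
    (f fd : ℝ → ℝ)
    (hf_pos : ∀ t > (0 : ℝ), 0 < f t)
    (hf_deriv : ∀ t > (0 : ℝ), HasDerivAt f (fd t) t)
    (hfd_neg : ∀ t > (0 : ℝ), fd t < 0)
    (hf_mlr : AntitoneOn (fun t => t * fd t / f t) (Ioi 0))
    (z : ℝ → ℝ → ℝ)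
    -- z_m(y) solves the defining equation with y + z_m(y) ≥ 0, and is unique
    (hz_eq : ∀ m > (0 : ℝ), ∀ y : ℝ,
      (∫ v in Ioi (0 : ℝ), ∫ u in Iio (v * y),
        ρd (u + z m y * v) * v ^ m * f (u ^ 2 + v ^ 2)) = 0)
    (hz_pos : ∀ m > (0 : ℝ), ∀ y : ℝ, 0 ≤ y + z m y)
    (hz_unique : ∀ m > (0 : ℝ), ∀ y z' : ℝ,
      ((∫ v in Ioi (0 : ℝ), ∫ u in Iio (v * y),
        ρd (u + z' * v) * v ^ m * f (u ^ 2 + v ^ 2)) = 0 ∧ 0 ≤ y + z') → z' = z m y)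
    -- all integrals converge absolutely
    (h_int : ∀ m > (0 : ℝ), ∀ y c : ℝ, IntegrableOn
      (fun pr : ℝ × ℝ => ρd (pr.1 + c * pr.2) * pr.2 ^ m * f (pr.1 ^ 2 + pr.2 ^ 2))
      {pr : ℝ × ℝ | 0 < pr.2 ∧ pr.1 < pr.2 * y}) :
    ∀ y : ℝ, AntitoneOn (fun m => z m y) (Ioi 0) := by
  have hρd : ∀ t, ρd t = p * oddPow p t := fun t => by rw [hρd_def, oddPow, mul_assoc]
  have hfc : ContinuousOn f (Ioi 0) := fun t ht => (hf_deriv t ht).continuousAt.continuousWithinAt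
  have hzero : ∀ m > 0, ∀ y c : ℝ, (∫ v in Ioi (0 : ℝ), ∫ u in Iio (v * y),
      ρd (u + c * v) * v ^ m * f (u ^ 2 + v ^ 2)) = 0 ↔
        estimating p ((p + m + 1) / 2) y c = 0 := by
    intro m hm y c
    have hi := h_int m hm y c
    simp only [hρd, mul_assoc] at hi ⊢
    rw [IntegrableOn, integrable_const_mul_iff hp.ne'.isUnit] at hi
    simp only [← mul_assoc] at hi
    obtain ⟨K, hK, heq⟩ := exists_pos_mul_estimating hf_pos hfc hi
    simp only [mul_assoc] at heq
    simp only [integral_const_mul]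
    rw [heq]
    simp [hp.ne', hK.ne']
  intro y m hm m' hm' hmm'
  have hm0 : 0 < m := hm
  obtain ⟨c', hle, hnonneg, hc'⟩ := exists_zero_le_of_estimating_eq_zero hp
    (by linarith : p < 2 * ((p + m + 1) / 2))
    (by linarith : (p + m + 1) / 2 ≤ (p + m' + 1) / 2) (hz_pos m hm y)
    ((hzero m hm y _).1 (hz_eq m hm y))
  have huniq := hz_unique m' hm' y c' ⟨(hzero m' hm' y c').2 hc', hnonneg⟩
  exact huniq.symm.le.trans hle
end

section
/- Let n ≥ 1 be an integer, let f satisfy the model assumption, and let ρ be a strictly bowl-shaped loss satisfying |ρ'(-u)| ≤ |ρ'(u)| for all u > 0. Let c₀ be the MRE constant and let g_{π0} satisfy B_n(y, g_{π0}(y)) = 0 and y + c₀ + g_{π0}(y) ≥ 0 for every y (all integrals absolutely convergent, and the risk framework of the paper in force). Then k(y) := y + c₀ + g_{π0}(y) satisfies k(y) > 0 and y·k(y) < 1 + y² for every y ∈ ℝ. Equivalently, the generalized Bayes estimate satisfies δ_{π0}(x,s) = s·k(x/s) < x + s²/x for every x > 0, s > 0. -/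
open MeasureTheory Set

/-- Integrating `F` over the wedge `{v > 0, u < v * y}` is the same as integrating over the open
first quadrant in the coordinates `(t, v)` with `u = v * y - t`. -/
lemma integral_wedge_eq_quadrant {F : ℝ → ℝ → ℝ} (y : ℝ)
    (hF : IntegrableOn (fun p : ℝ × ℝ => F p.1 p.2) {p : ℝ × ℝ | 0 < p.2}) :
    Integrable ((Ioi (0 : ℝ) ×ˢ Ioi (0 : ℝ)).indicator
        (fun p : ℝ × ℝ => F (p.2 * y - p.1) p.2)) ∧
      ∫ p, (Ioi (0 : ℝ) ×ˢ Ioi (0 : ℝ)).indicator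
        (fun p : ℝ × ℝ => F (p.2 * y - p.1) p.2) p =
      ∫ v in Ioi (0 : ℝ), ∫ u in Iio (v * y), F u v := by
  set W : Set (ℝ × ℝ) := {p | 0 < p.1 ∧ p.2 < p.1 * y} with hW
  have hWm : MeasurableSet W :=
    (measurableSet_lt measurable_const measurable_fst).inter
      (measurableSet_lt measurable_snd (measurable_fst.mul_const y))
  set G : ℝ × ℝ → ℝ := W.indicator (fun p => F p.2 p.1) with hG
  have hGint : Integrable G := by
    have h1 := (integrable_indicator_iff
      (measurableSet_lt measurable_const measurable_snd)).2 hF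
    rw [Measure.volume_eq_prod] at h1
    have h2 := h1.swap.indicator hWm
    rw [← Measure.volume_eq_prod] at h2
    refine h2.congr (.of_forall fun p => ?_)
    by_cases hp : p ∈ W
    · simp only [hG, indicator_of_mem hp, Function.comp]
      rw [indicator_of_mem (show p.swap ∈ {p : ℝ × ℝ | 0 < p.2} from hp.1)]
      rfl
    · simp only [hG, indicator_of_notMem hp]
  have hΦ : MeasurePreserving (fun p : ℝ × ℝ => (p.1, p.1 * y - p.2)) volume volume :=
    (MeasurePreserving.id volume).skew_product (g := fun a b : ℝ => a * y - b)
      (by fun_prop)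
      (.of_forall fun a => (Measure.measurePreserving_sub_left volume (a * y)).map_eq)
  have hcomp : (Ioi (0 : ℝ) ×ˢ Ioi (0 : ℝ)).indicator
      (fun p : ℝ × ℝ => F (p.2 * y - p.1) p.2) =
      (fun p : ℝ × ℝ => G (p.1, p.1 * y - p.2)) ∘ Prod.swap := by
    funext p
    by_cases hp : 0 < p.1 ∧ 0 < p.2
    · rw [indicator_of_mem (show p ∈ Ioi (0 : ℝ) ×ˢ Ioi (0 : ℝ) from hp)]
      have : (p.2, p.2 * y - p.1) ∈ W := ⟨hp.2, by simpa using hp.1⟩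
      simp [hG, indicator_of_mem this]
    · rw [indicator_of_notMem (show p ∉ Ioi (0 : ℝ) ×ˢ Ioi (0 : ℝ) from hp)]
      have : (p.2, p.2 * y - p.1) ∉ W := fun h => hp ⟨by simpa using h.2, h.1⟩
      simp [hG, indicator_of_notMem this]
  have hHint : Integrable (fun p : ℝ × ℝ => G (p.1, p.1 * y - p.2)) :=
    hΦ.integrable_comp_of_integrable hGint
  refine ⟨?_, ?_⟩
  · rw [hcomp]
    rw [Measure.volume_eq_prod] at hHint ⊢
    exact hHint.swap
  · rw [hcomp]
    have e1 : ∫ p, ((fun p : ℝ × ℝ => G (p.1, p.1 * y - p.2)) ∘ Prod.swap) p =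
        ∫ p : ℝ × ℝ, G (p.1, p.1 * y - p.2) := by
      rw [Measure.volume_eq_prod]
      exact integral_prod_swap (fun p : ℝ × ℝ => G (p.1, p.1 * y - p.2))
    have e2 : ∫ p : ℝ × ℝ, G (p.1, p.1 * y - p.2) = ∫ p, G p := by
      conv_rhs => rw [← hΦ.map_eq]
      rw [integral_map hΦ.aemeasurable (by rw [hΦ.map_eq]; exact hGint.aestronglyMeasurable)]
    have e3 : ∫ p, G p = ∫ v, ∫ u, G (v, u) := by
      rw [Measure.volume_eq_prod] at hGint ⊢
      exact integral_prod G hGint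
    rw [e1, e2, e3, ← integral_indicator measurableSet_Ioi]
    refine integral_congr_ae (.of_forall fun v => ?_)
    by_cases hv : 0 < v
    · simp only [indicator_of_mem (show v ∈ Ioi (0 : ℝ) from hv)]
      rw [← integral_indicator measurableSet_Iio]
      refine integral_congr_ae (.of_forall fun u => ?_)
      simp only [hG, indicator, hW, mem_ofPred_eq, mem_Iio, hv, true_and]
    · simp only [indicator_of_notMem (show v ∉ Ioi (0 : ℝ) from hv)]
      simp [hG, hW, hv]

/-- An integrable function on the plane whose symmetrization under the reflections
`v ↦ κ * t - v` is almost everywhere nonnegative, and positive on a set of positive measure,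
has positive integral. -/
lemma integral_pos_of_reflection {H : ℝ × ℝ → ℝ} (κ : ℝ) (hH : Integrable H)
    (hnonneg : ∀ᵐ p : ℝ × ℝ, 0 ≤ H p + H (p.1, p.1 * κ - p.2))
    {Q : Set (ℝ × ℝ)} (hQ : 0 < volume Q)
    (hpos : ∀ p ∈ Q, 0 < H p + H (p.1, p.1 * κ - p.2)) : 0 < ∫ p, H p := by
  have hT : MeasurePreserving (fun p : ℝ × ℝ => (p.1, p.1 * κ - p.2)) volume volume :=
    (MeasurePreserving.id volume).skew_product (g := fun a b : ℝ => a * κ - b)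
      (by fun_prop)
      (.of_forall fun a => (Measure.measurePreserving_sub_left volume (a * κ)).map_eq)
  have hHT : Integrable (fun p : ℝ × ℝ => H (p.1, p.1 * κ - p.2)) :=
    hT.integrable_comp_of_integrable hH
  have e : ∫ p : ℝ × ℝ, H (p.1, p.1 * κ - p.2) = ∫ p, H p := by
    conv_rhs => rw [← hT.map_eq]
    rw [integral_map hT.aemeasurable (by rw [hT.map_eq]; exact hH.aestronglyMeasurable)]
  have h2 : 0 < ∫ p : ℝ × ℝ, (H p + H (p.1, p.1 * κ - p.2)) := by
    rw [integral_pos_iff_support_of_nonneg_ae hnonneg (hH.add hHT)]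
    exact hQ.trans_le (measure_mono fun p hp => (hpos p hp).ne')
  rw [integral_add hH hHT, e] at h2
  linarith

/-- Lines `v = m * t` are null sets in the plane. -/
lemma ae_snd_ne_fst_mul (m : ℝ) : ∀ᵐ p : ℝ × ℝ, p.2 ≠ p.1 * m := by
  have hs : MeasurableSet {p : ℝ × ℝ | p.2 = p.1 * m} :=
    measurableSet_eq_fun measurable_snd (measurable_fst.mul_const m)
  have h0 : volume {p : ℝ × ℝ | p.2 = p.1 * m} = 0 := by
    rw [Measure.volume_eq_prod, Measure.measure_prod_null hs]
    refine .of_forall fun t => ?_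
    have : Prod.mk t ⁻¹' {p : ℝ × ℝ | p.2 = p.1 * m} = {t * m} := by
      ext v; simp
    simp [this]
  exact measure_eq_zero_iff_ae_notMem.1 h0

/-- Comparison of the integrand at a point `v` with its reflection `v'`, where
`v + v' = 2 t / k` and `v' < v`. -/
lemma integrand_add_reflection_pos {n : ℕ} (hn : n ≠ 0) {f ρd : ℝ → ℝ}
    (hf_pos : ∀ t > (0 : ℝ), 0 < f t) (hf_anti : AntitoneOn f (Ioi 0))
    (hρd_neg : ∀ t < (0 : ℝ), ρd t < 0) (hρd_pos : ∀ t > (0 : ℝ), 0 < ρd t)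
    (hρ_asym : ∀ u > (0 : ℝ), |ρd (-u)| ≤ |ρd u|)
    {y k t v v' : ℝ} (hk : 0 < k) (hyk : 1 + y ^ 2 ≤ y * k) (hv' : 0 < v')
    (hvv : v' < v) (hsum : k * (v + v') = 2 * t) :
    0 < ρd (k * v - t) * v ^ n * f ((v * y - t) ^ 2 + v ^ 2) +
      ρd (k * v' - t) * v' ^ n * f ((v' * y - t) ^ 2 + v' ^ 2) := by
  have hv : 0 < v := hv'.trans hvv
  have hw : 0 < k * v - t := by nlinarith
  have hw' : k * v' - t = -(k * v - t) := by linarith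
  have hρ : -ρd (k * v' - t) ≤ ρd (k * v - t) := by
    have h := hρ_asym _ hw
    rwa [← hw', abs_of_neg (hρd_neg _ (by linarith)), abs_of_pos (hρd_pos _ hw)] at h
  have hρ' : 0 < -ρd (k * v' - t) := neg_pos.2 (hρd_neg _ (by linarith))
  have hpow : v' ^ n < v ^ n := pow_lt_pow_left₀ hvv hv'.le hn
  have hq' : 0 < (v' * y - t) ^ 2 + v' ^ 2 := by positivity
  have hq : 0 < (v * y - t) ^ 2 + v ^ 2 := by positivity
  have hle : (v * y - t) ^ 2 + v ^ 2 ≤ (v' * y - t) ^ 2 + v' ^ 2 := by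
    have h1 : (1 + y ^ 2) * (v + v') ≤ y * (2 * t) := by
      rw [← hsum]; nlinarith
    nlinarith
  have hfle := hf_anti hq hq' hle
  have hf' := hf_pos _ hq'
  have key : -ρd (k * v' - t) * v' ^ n * f ((v' * y - t) ^ 2 + v' ^ 2) <
      ρd (k * v - t) * v ^ n * f ((v * y - t) ^ 2 + v ^ 2) := by
    have hvn : 0 < v' ^ n := by positivity
    calc _ < -ρd (k * v' - t) * v ^ n * f ((v' * y - t) ^ 2 + v' ^ 2) := by gcongr
      _ ≤ _ := by
        have hρv := (hρd_pos _ hw).le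
        gcongr
  linarith

/-- Lemma 7: for a model density `f` satisfying the model assumption and a strictly
bowl-shaped loss with `|ρ'(-u)| ≤ |ρ'(u)|` for `u > 0`, the function
`k(y) = y + c₀ + g_{π0}(y)` satisfies `k(y) > 0` and `y·k(y) < 1 + y²` for every `y`;
equivalently `δ_{π0}(x,s) = s·k(x/s) < x + s²/x` for all `x > 0`, `s > 0`. -/
theorem stmt13
    (n : ℕ) (hn : 1 ≤ n)
    -- the model assumption on f
    (f fd : ℝ → ℝ)
    (hf_pos : ∀ t > (0 : ℝ), 0 < f t)
    (hf_deriv : ∀ t > (0 : ℝ), HasDerivAt f (fd t) t)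
    (hfd_neg : ∀ t > (0 : ℝ), fd t < 0)
    (hf_mlr : AntitoneOn (fun t => t * fd t / f t) (Ioi 0))
    -- strictly bowl-shaped loss with the asymmetry condition
    (ρ ρd : ℝ → ℝ) (hρd_meas : Measurable ρd)
    (hρ0 : ρ 0 = 0) (hρ_nonneg : ∀ t, 0 ≤ ρ t)
    (hρd_neg : ∀ t < (0 : ℝ), ρd t < 0) (hρd_pos : ∀ t > (0 : ℝ), 0 < ρd t)
    (hρ_ftc : ∀ a b : ℝ, ρ b - ρ a = ∫ t in a..b, ρd t)
    (hρ_asym : ∀ u > (0 : ℝ), |ρd (-u)| ≤ |ρd u|)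
    -- c₀ is the MRE constant
    (c₀ : ℝ)
    (hc₀ : (∫ v in Ioi (0 : ℝ), ∫ u : ℝ,
        ρd (u + c₀ * v) * v ^ n * f (u ^ 2 + v ^ 2)) = 0)
    -- g_{π0} satisfies B_n(y, g_{π0}(y)) = 0 and y + c₀ + g_{π0}(y) ≥ 0
    (gpi : ℝ → ℝ)
    (hgpi_eq : ∀ y : ℝ, (∫ v in Ioi (0 : ℝ), ∫ u in Iio (v * y),
        ρd (u + c₀ * v + gpi y * v) * v ^ n * f (u ^ 2 + v ^ 2)) = 0)
    (hgpi_pos : ∀ y : ℝ, 0 ≤ y + c₀ + gpi y)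
    -- absolute convergence of the integrals involved
    (h_int : ∀ z : ℝ, IntegrableOn
      (fun pr : ℝ × ℝ =>
        ρd (pr.1 + c₀ * pr.2 + z * pr.2) * pr.2 ^ n * f (pr.1 ^ 2 + pr.2 ^ 2))
      {pr : ℝ × ℝ | 0 < pr.2}) :
    (∀ y : ℝ, 0 < y + c₀ + gpi y ∧ y * (y + c₀ + gpi y) < 1 + y ^ 2) ∧
    (∀ x > (0 : ℝ), ∀ s > (0 : ℝ),
      s * (x / s + c₀ + gpi (x / s)) < x + s ^ 2 / x) := by
  have hf_anti : AntitoneOn f (Ioi 0) := by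
    refine (strictAntiOn_of_deriv_neg (convex_Ioi 0)
      (fun t ht => (hf_deriv t ht).continuousAt.continuousWithinAt) fun t ht => ?_).antitoneOn
    rw [interior_Ioi] at ht
    rw [(hf_deriv t ht).deriv]
    exact hfd_neg t ht
  have hquad : ∀ a b : ℝ, ∀ v > (0 : ℝ), 0 < f ((v * a - b) ^ 2 + v ^ 2) :=
    fun a b v hv => hf_pos _ (by positivity)
  have main : ∀ y : ℝ, 0 < y + c₀ + gpi y ∧ y * (y + c₀ + gpi y) < 1 + y ^ 2 := by
    intro y
    set k := y + c₀ + gpi y with hkdef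
    obtain ⟨hint, hzero⟩ := integral_wedge_eq_quadrant
      (F := fun u v => ρd (u + c₀ * v + gpi y * v) * v ^ n * f (u ^ 2 + v ^ 2)) y (h_int (gpi y))
    rw [hgpi_eq y] at hzero
    have harg : ∀ t v : ℝ, v * y - t + c₀ * v + gpi y * v = k * v - t := by
      intro t v; rw [hkdef]; ring
    simp only [harg] at hint hzero
    set H : ℝ × ℝ → ℝ := (Ioi (0 : ℝ) ×ˢ Ioi (0 : ℝ)).indicator
      (fun p => ρd (k * p.2 - p.1) * p.2 ^ n * f ((p.2 * y - p.1) ^ 2 + p.2 ^ 2))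
    have hHin : ∀ {t v : ℝ}, 0 < t → 0 < v →
        H (t, v) = ρd (k * v - t) * v ^ n * f ((v * y - t) ^ 2 + v ^ 2) :=
      fun {t v} ht hv =>
        indicator_of_mem (show (t, v) ∈ Ioi (0 : ℝ) ×ˢ Ioi (0 : ℝ) from ⟨ht, hv⟩) _
    have hHout : ∀ {t v : ℝ}, ¬ (0 < t ∧ 0 < v) → H (t, v) = 0 :=
      fun {t v} h =>
        indicator_of_notMem (show (t, v) ∉ Ioi (0 : ℝ) ×ˢ Ioi (0 : ℝ) from h) _
    have hk : 0 < k := by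
      refine (hgpi_pos y).lt_of_ne fun hk0 => ?_
      replace hk0 : k = 0 := hk0.symm
      have hneg : ∀ t v : ℝ, 0 < t → 0 < v → H (t, v) < 0 := by
        intro t v ht hv
        rw [hHin ht hv]
        have := hρd_neg (k * v - t) (by rw [hk0]; linarith)
        exact mul_neg_of_neg_of_pos (mul_neg_of_neg_of_pos this (by positivity)) (hquad _ _ _ hv)
      have hpos : 0 < ∫ p, -H p := by
        rw [integral_pos_iff_support_of_nonneg_ae (f := fun p => -H p) _ hint.neg]
        · refine lt_of_lt_of_le ?_ (measure_mono (s := Ioi (0 : ℝ) ×ˢ Ioi (0 : ℝ))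
            fun p hp => (neg_pos.2 (hneg p.1 p.2 hp.1 hp.2)).ne')
          exact (isOpen_Ioi.prod isOpen_Ioi).measure_pos volume ⟨(1, 1), by simp⟩
        · refine .of_forall fun p => ?_
          by_cases hp : 0 < p.1 ∧ 0 < p.2
          · exact (neg_pos.2 (hneg p.1 p.2 hp.1 hp.2)).le
          · exact (neg_eq_zero.2 (hHout hp)).ge
      rw [integral_neg, hzero, neg_zero] at hpos
      exact hpos.false
    refine ⟨hk, ?_⟩
    by_contra! hyk
    have hlt : ∀ t v v' : ℝ, 0 < t → v' < v → k * (v + v') = 2 * t →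
        0 < H (t, v) + H (t, v') := by
      intro t v v' ht hvv hsum
      have hw : 0 < k * v - t := by nlinarith
      have hv : 0 < v := by
        by_contra! h
        nlinarith
      by_cases hv' : 0 < v'
      · rw [hHin ht hv, hHin ht hv']
        exact integrand_add_reflection_pos (by omega) hf_pos hf_anti hρd_neg hρd_pos hρ_asym
          hk hyk hv' hvv hsum
      · rw [hHin ht hv, hHout fun h => hv' h.2, add_zero]
        exact mul_pos (mul_pos (hρd_pos _ hw) (by positivity)) (hquad _ _ _ hv)
    have hsum : ∀ t v : ℝ, k * (v + (t * (2 / k) - v)) = 2 * t := by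
      intro t v; field_simp; ring
    have hsum' : ∀ t v : ℝ, k * (t * (2 / k) - v + v) = 2 * t := by
      intro t v; rw [add_comm]; exact hsum t v
    have hHpos : 0 < ∫ p, H p := by
      refine integral_pos_of_reflection (2 / k) hint ?_
        (Q := {p | 0 < p.1 ∧ p.1 * (2 / k) - p.2 < p.2}) ?_ ?_
      · filter_upwards [ae_snd_ne_fst_mul (1 / k)] with ⟨t, v⟩ hne
        by_cases ht : 0 < t
        · rcases lt_trichotomy v (t * (2 / k) - v) with h | h | h
          · rw [add_comm]
            exact (hlt t _ v ht h (hsum' t v)).le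
          · exact absurd (show v = t * (1 / k) by linear_combination h / 2) hne
          · exact (hlt t v _ ht h (hsum t v)).le
        · simp [hHout fun h => ht h.1]
      · refine IsOpen.measure_pos volume ?_ ⟨(1, 2 / k), ?_⟩
        · exact (isOpen_lt continuous_const continuous_fst).inter
            (isOpen_lt (by fun_prop) continuous_snd)
        · have : 0 < 2 / k := by positivity
          simpa using this
      · rintro ⟨t, v⟩ ⟨ht, h⟩
        exact hlt t v _ ht h (hsum t v)
    exact hHpos.ne' hzero
  refine ⟨main, fun x hx s hs => ?_⟩
  have h := (main (x / s)).2
  set K := x / s + c₀ + gpi (x / s)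
  have e : x + s ^ 2 / x - s * K = s ^ 2 / x * (1 + (x / s) ^ 2 - x / s * K) := by
    field_simp
    ring
  have : 0 < s ^ 2 / x * (1 + (x / s) ^ 2 - x / s * K) :=
    mul_pos (by positivity) (by linarith)
  linarith
end

section
/- Let f satisfy the model assumption. Then for any 0 < α₀ < α₁ and any ε > 0, the likelihood ratio w ↦ f(α₁(w+ε)) / f(α₀(w+ε)) is nonincreasing in w on (0,∞). Consequently, for y ≤ 0 the family of densities f_{λ,y}(t) proportional to tⁿ f(λ²(1+y²){(t - y/(1+y²))² + (1+y²)^{-2}}) on (0,∞) has decreasing monotone likelihood ratio in w = (t - y/(1+y²))² with parameter λ. -/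
open MeasureTheory Set

/-- If `t * fd t / f t` is nonincreasing on `(0, ∞)`, where `fd` is the derivative of `f > 0`,
then so is `f (b * u) / f (a * u)`
whenever `0 < a ≤ b`. -/
theorem antitoneOn_div_comp_mul_of_antitoneOn_mul_deriv_div {f fd : ℝ → ℝ}
    (hf_pos : ∀ t > (0 : ℝ), 0 < f t)
    (hf_deriv : ∀ t > (0 : ℝ), HasDerivAt f (fd t) t)
    (hf_mlr : AntitoneOn (fun t => t * fd t / f t) (Ioi 0))
    {a b : ℝ} (ha : 0 < a) (hab : a ≤ b) :
    AntitoneOn (fun u => f (b * u) / f (a * u)) (Ioi 0) := by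
  have comp_deriv : ∀ c > (0 : ℝ), ∀ u > (0 : ℝ),
      HasDerivAt (fun u => f (c * u)) (fd (c * u) * c) u := fun c hc u hu => by
    simpa [Function.comp_def] using (hf_deriv (c * u) (mul_pos hc hu)).comp u ((hasDerivAt_const_mul c))
  have hb : 0 < b := ha.trans_le hab
  have ratio_deriv : ∀ u > (0 : ℝ), HasDerivAt (fun u => f (b * u) / f (a * u))
      ((fd (b * u) * b * f (a * u) - f (b * u) * (fd (a * u) * a)) / f (a * u) ^ 2) u :=
    fun u hu => (comp_deriv b hb u hu).div (comp_deriv a ha u hu)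
      (hf_pos _ (mul_pos ha hu)).ne'
  refine antitoneOn_of_hasDerivWithinAt_nonpos (convex_Ioi 0)
    (fun u hu => (ratio_deriv u hu).continuousAt.continuousWithinAt)
    (fun u hu => (ratio_deriv u (interior_subset hu)).hasDerivWithinAt) fun u hu => ?_
  replace hu : 0 < u := interior_subset hu
  have hau : 0 < a * u := mul_pos ha hu
  have hbu : 0 < b * u := mul_pos hb hu
  have key : b * u * fd (b * u) / f (b * u) ≤ a * u * fd (a * u) / f (a * u) :=
    hf_mlr hau hbu (mul_le_mul_of_nonneg_right hab hu.le)
  rw [div_le_div_iff₀ (hf_pos _ hbu) (hf_pos _ hau)] at key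
  refine div_nonpos_of_nonpos_of_nonneg (nonpos_of_mul_nonpos_right ?_ hu) (sq_nonneg _)
  linarith

/-- Remark (mlr property): under the model assumption, for `0 < α₀ < α₁` and `ε > 0` the
likelihood ratio `w ↦ f(α₁(w+ε))/f(α₀(w+ε))` is nonincreasing on `(0,∞)`; consequently,
for `y ≤ 0` the (unnormalized) densities
`f_{λ,y}(t) ∝ tⁿ f(λ²(1+y²){(t - y/(1+y²))² + (1+y²)^{-2}})` on `(0,∞)` have decreasing
monotone likelihood ratio in `w = (t - y/(1+y²))²` with parameter `λ`. -/
theorem stmt17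
    (f fd : ℝ → ℝ)
    (hf_pos : ∀ t > (0 : ℝ), 0 < f t)
    (hf_deriv : ∀ t > (0 : ℝ), HasDerivAt f (fd t) t)
    (hfd_neg : ∀ t > (0 : ℝ), fd t < 0)
    (hf_mlr : AntitoneOn (fun t => t * fd t / f t) (Ioi 0))
    (n : ℕ) (hn : 1 ≤ n) :
    (∀ α₀ α₁ ε : ℝ, 0 < α₀ → α₀ < α₁ → 0 < ε →
      AntitoneOn (fun w => f (α₁ * (w + ε)) / f (α₀ * (w + ε))) (Ioi 0)) ∧
    (∀ y : ℝ, y ≤ 0 → ∀ lam₀ lam₁ : ℝ, 0 < lam₀ → lam₀ < lam₁ →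
      ∀ t₁ ∈ Ioi (0 : ℝ), ∀ t₂ ∈ Ioi (0 : ℝ),
        (t₁ - y / (1 + y ^ 2)) ^ 2 ≤ (t₂ - y / (1 + y ^ 2)) ^ 2 →
        (t₂ ^ n * f (lam₁ ^ 2 * (1 + y ^ 2) *
            ((t₂ - y / (1 + y ^ 2)) ^ 2 + 1 / (1 + y ^ 2) ^ 2))) *
          (t₁ ^ n * f (lam₀ ^ 2 * (1 + y ^ 2) *
            ((t₁ - y / (1 + y ^ 2)) ^ 2 + 1 / (1 + y ^ 2) ^ 2))) ≤
        (t₁ ^ n * f (lam₁ ^ 2 * (1 + y ^ 2) *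
            ((t₁ - y / (1 + y ^ 2)) ^ 2 + 1 / (1 + y ^ 2) ^ 2))) *
          (t₂ ^ n * f (lam₀ ^ 2 * (1 + y ^ 2) *
            ((t₂ - y / (1 + y ^ 2)) ^ 2 + 1 / (1 + y ^ 2) ^ 2)))) := by
  refine ⟨fun α₀ α₁ ε hα₀ hα hε w₁ hw₁ w₂ hw₂ hw => ?_,
    fun y _ lam₀ lam₁ hlam₀ hlam t₁ ht₁ t₂ ht₂ hw => ?_⟩
  · exact antitoneOn_div_comp_mul_of_antitoneOn_mul_deriv_div hf_pos hf_deriv hf_mlr hα₀ hα.le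
      (add_pos hw₁ hε) (add_pos hw₂ hε) (add_le_add_left hw ε)
  · have hy : 0 < 1 + y ^ 2 := by positivity
    have ht₁ : 0 < t₁ := ht₁
    have ht₂ : 0 < t₂ := ht₂
    set u₁ := (t₁ - y / (1 + y ^ 2)) ^ 2 + 1 / (1 + y ^ 2) ^ 2 with hu₁_def
    set u₂ := (t₂ - y / (1 + y ^ 2)) ^ 2 + 1 / (1 + y ^ 2) ^ 2 with hu₂_def
    have hu₁ : 0 < u₁ := by positivity
    have hu₂ : 0 < u₂ := by positivity
    have hu : u₁ ≤ u₂ := add_le_add_left hw _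
    have hα₀ : 0 < lam₀ ^ 2 * (1 + y ^ 2) := by positivity
    have hα : lam₀ ^ 2 * (1 + y ^ 2) ≤ lam₁ ^ 2 * (1 + y ^ 2) := by gcongr
    have key := antitoneOn_div_comp_mul_of_antitoneOn_mul_deriv_div hf_pos hf_deriv hf_mlr
      hα₀ hα hu₁ hu₂ hu
    rw [div_le_div_iff₀ (hf_pos _ (mul_pos hα₀ hu₂)) (hf_pos _ (mul_pos hα₀ hu₁))] at key
    have := mul_le_mul_of_nonneg_left key (show 0 ≤ t₁ ^ n * t₂ ^ n by positivity)
    linarith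
end

section
/- Let f satisfy the model assumption, let n ≥ 1 be an integer, p ≥ 1, and let a ∈ ℝ, ε > 0, and K > max(a, 0) be constants. For α > 0 let W_α be a random variable on (0,∞) with density proportional to |w/K - 1|^{p-1} · wⁿ · f(α((w-a)² + ε)), assuming these densities are well defined (finite normalizing constants) for every α > 0. Then α ↦ P(W_α > K) is nonincreasing on (0,∞). -/
open MeasureTheory Set

/-- If `t * fd t / f t` is nonincreasing, where `fd` is the derivative of `f`, then so is
`q ↦ f (β * q) / f (α * q)` for `0 < α ≤ β`. -/
lemma antitoneOn_div_comp_mul {f fd : ℝ → ℝ}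
    (hf_pos : ∀ t > (0 : ℝ), 0 < f t)
    (hf_deriv : ∀ t > (0 : ℝ), HasDerivAt f (fd t) t)
    (hf_mlr : AntitoneOn (fun t => t * fd t / f t) (Ioi 0))
    {α β : ℝ} (hα : 0 < α) (hαβ : α ≤ β) :
    AntitoneOn (fun q => f (β * q) / f (α * q)) (Ioi 0) := by
  have hβ : 0 < β := hα.trans_le hαβ
  have hd : ∀ q > (0 : ℝ), HasDerivAt (fun q => f (β * q) / f (α * q))
      ((fd (β * q) * β * f (α * q) - f (β * q) * (fd (α * q) * α)) / f (α * q) ^ 2) q := by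
    intro q hq
    have hc : ∀ c > (0 : ℝ), HasDerivAt (fun q => f (c * q)) (fd (c * q) * c) q := by
      intro c hc
      have h := (hasDerivAt_id q).const_mul c
      rw [mul_one] at h
      exact (hf_deriv (c * q) (mul_pos hc hq)).comp q h
    exact (hc β hβ).div (hc α hα) (hf_pos _ (mul_pos hα hq)).ne'
  refine antitoneOn_of_deriv_nonpos (convex_Ioi 0)
    (fun q hq => (hd q hq).continuousAt.continuousWithinAt) ?_ ?_
  · rw [interior_Ioi]
    exact fun q hq => (hd q hq).differentiableAt.differentiableWithinAt
  · rw [interior_Ioi]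
    intro q (hq : 0 < q)
    rw [(hd q hq).deriv]
    refine div_nonpos_of_nonpos_of_nonneg ?_ (sq_nonneg _)
    have hfα := hf_pos _ (mul_pos hα hq)
    have hfβ := hf_pos _ (mul_pos hβ hq)
    have h : β * q * fd (β * q) / f (β * q) ≤ α * q * fd (α * q) / f (α * q) :=
      hf_mlr (mul_pos hα hq) (mul_pos hβ hq) (mul_le_mul_of_nonneg_right hαβ hq.le)
    rw [div_le_div_iff₀ hfβ hfα] at h
    refine nonpos_of_mul_nonpos_right (a := q) ?_ hq
    linarith

/-- If the part of `φ` that is even about `a` changes sign from `-` to `+` along `|w - a|`, then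
multiplying the weight `A |w - a|` by a nonincreasing function of `|w - a|` keeps the weighted
integral of `φ` nonpositive. -/
lemma integral_mul_nonpos_of_reflected_sign_change {φ A B : ℝ → ℝ} {a : ℝ}
    (hA : ∀ u, 0 < A u) (hB : ∀ u, 0 < B u)
    (hAB : ∀ u v, 0 ≤ u → u ≤ v → B v / A v ≤ B u / A u)
    (hsign : ∀ u v, 0 ≤ u → u < v → 0 < φ (a + u) + φ (a - u) → 0 ≤ φ (a + v) + φ (a - v))
    (hiA : Integrable fun w => φ w * A |w - a|) (hiB : Integrable fun w => φ w * B |w - a|)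
    (hle : ∫ w, φ w * A |w - a| ≤ 0) :
    ∫ w, φ w * B |w - a| ≤ 0 := by
  have hS : ∀ w, φ w + φ (2 * a - w) = φ (a + |w - a|) + φ (a - |w - a|) := by
    intro w
    rcases abs_cases (w - a) with ⟨h, -⟩ | ⟨h, -⟩ <;> rw [h]
    · ring_nf
    · rw [add_comm]; ring_nf
  have habs : ∀ w, |2 * a - w - a| = |w - a| := by
    intro w
    rw [abs_sub_comm w a]; ring_nf
  have hrefl : ∀ C : ℝ → ℝ, Integrable (fun w => φ w * C |w - a|) →
      Integrable (fun w => (φ w + φ (2 * a - w)) * C |w - a|) ∧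
      ∫ w, (φ w + φ (2 * a - w)) * C |w - a| = 2 * ∫ w, φ w * C |w - a| := by
    intro C hC
    have h1 := hC.comp_sub_left (2 * a)
    have h2 := integral_sub_left_eq_self (fun w => φ w * C |w - a|) volume (2 * a)
    simp only [habs] at h1 h2
    simp only [add_mul]
    exact ⟨hC.add h1, by rw [integral_add hC h1, h2, two_mul]⟩
  obtain ⟨hSA, hSA'⟩ := hrefl A hiA
  obtain ⟨hSB, hSB'⟩ := hrefl B hiB
  suffices h : ∫ w, (φ w + φ (2 * a - w)) * B |w - a| ≤ 0 by linarith
  by_cases hne : ∃ u, 0 ≤ u ∧ 0 < φ (a + u) + φ (a - u)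
  · set T : Set ℝ := {u | 0 ≤ u ∧ 0 < φ (a + u) + φ (a - u)}
    have hTne : T.Nonempty := hne
    have hTb : BddBelow T := ⟨0, fun u hu => hu.1⟩
    have hu₀ : 0 ≤ sInf T := le_csInf hTne fun u hu => hu.1
    set r := B (sInf T) / A (sInf T) with hr
    have hr0 : 0 ≤ r := (div_pos (hB _) (hA _)).le
    calc ∫ w, (φ w + φ (2 * a - w)) * B |w - a|
        ≤ ∫ w, r * ((φ w + φ (2 * a - w)) * A |w - a|) := by
          refine integral_mono hSB (hSA.const_mul r) fun w => ?_
          simp only [hS]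
          have hu : 0 ≤ |w - a| := abs_nonneg _
          generalize |w - a| = u at hu
          have hBA : B u = B u / A u * A u := (div_mul_cancel₀ _ (hA u).ne').symm
          suffices h : (φ (a + u) + φ (a - u)) * (B u / A u) ≤ (φ (a + u) + φ (a - u)) * r by
            have := mul_le_mul_of_nonneg_right h (hA u).le
            rw [hBA]
            linarith
          rcases lt_trichotomy u (sInf T) with h | h | h
          · have hn : φ (a + u) + φ (a - u) ≤ 0 := by
              by_contra! hc
              exact notMem_of_lt_csInf h hTb ⟨hu, hc⟩
            exact mul_le_mul_of_nonpos_left (hAB _ _ hu h.le) hn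
          · rw [hr, ← h]
          · obtain ⟨v, hv, hvu⟩ := exists_lt_of_csInf_lt hTne h
            exact mul_le_mul_of_nonneg_left (hAB _ _ hu₀ h.le) (hsign v u hv.1 hvu hv.2)
      _ = r * ∫ w, (φ w + φ (2 * a - w)) * A |w - a| := integral_const_mul _ _
      _ ≤ 0 := mul_nonpos_of_nonneg_of_nonpos hr0 (by linarith)
  · push Not at hne
    refine integral_nonpos fun w => ?_
    simp only [hS]
    exact mul_nonpos_of_nonpos_of_nonneg (hne _ (abs_nonneg _)) (hB _).le

/-- The ratio of `|w / K - 1| ^ s * w ^ n` at `a + u` and at `a - u` is nondecreasing in `u`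
for `K - a < u < a`, in cross-multiplied form. -/
lemma weight_mul_reflected_le {a K s u v : ℝ} (n : ℕ) (hs : 0 ≤ s) (hK : 0 < K) (haK : a < K)
    (hu : K - a < u) (huv : u ≤ v) (hva : v < a) :
    (|(a + u) / K - 1| ^ s * (a + u) ^ n) * (|(a - v) / K - 1| ^ s * (a - v) ^ n) ≤
      (|(a + v) / K - 1| ^ s * (a + v) ^ n) * (|(a - u) / K - 1| ^ s * (a - u) ^ n) := by
  have hplus : ∀ x, K - a < x → |(a + x) / K - 1| = (x - (K - a)) / K := by
    intro x hx
    rw [div_sub_one hK.ne', abs_of_pos (div_pos (by linarith) hK)]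
    ring
  have hminus : ∀ x, K - a < x → |(a - x) / K - 1| = (x + (K - a)) / K := by
    intro x hx
    rw [div_sub_one hK.ne', abs_of_neg (div_neg_of_neg_of_pos (by linarith) hK)]
    ring
  have hv : K - a < v := hu.trans_le huv
  have key : ((u - (K - a)) / K * ((v + (K - a)) / K)) ^ s * ((a + u) * (a - v)) ^ n ≤
      ((v - (K - a)) / K * ((u + (K - a)) / K)) ^ s * ((a + v) * (a - u)) ^ n := by
    have h0 : 0 ≤ (u - (K - a)) / K * ((v + (K - a)) / K) :=
      mul_nonneg (div_nonneg (by linarith) hK.le) (div_nonneg (by linarith) hK.le)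
    have h1 : (u - (K - a)) / K * ((v + (K - a)) / K) ≤
        (v - (K - a)) / K * ((u + (K - a)) / K) := by
      rw [div_mul_div_comm, div_mul_div_comm]
      refine div_le_div_of_nonneg_right ?_ (mul_pos hK hK).le
      nlinarith
    have h2 : 0 ≤ (a + u) * (a - v) := mul_nonneg (by linarith) (by linarith)
    have h3 : (a + u) * (a - v) ≤ (a + v) * (a - u) := by nlinarith
    exact mul_le_mul (Real.rpow_le_rpow h0 h1 hs) (pow_le_pow_left₀ h2 h3 n)
      (pow_nonneg h2 n) (Real.rpow_nonneg (h0.trans h1) s)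
  rw [Real.mul_rpow (div_nonneg (by linarith) hK.le) (div_nonneg (by linarith) hK.le),
    Real.mul_rpow (div_nonneg (by linarith) hK.le) (div_nonneg (by linarith) hK.le),
    mul_pow, mul_pow] at key
  rw [hplus u hu, hplus v hv, hminus u hu, hminus v hv]
  linarith

/-- Key monotonicity step for the asymmetric `L^p` minimax proof: for `W_α` with density
proportional to `|w/K - 1|^{p-1} wⁿ f(α((w-a)² + ε))` on `(0,∞)`, the tail probability
`P(W_α > K)` is nonincreasing in `α` on `(0,∞)`. -/
theorem stmt18
    (f fd : ℝ → ℝ)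
    (hf_pos : ∀ t > (0 : ℝ), 0 < f t)
    (hf_deriv : ∀ t > (0 : ℝ), HasDerivAt f (fd t) t)
    (hfd_neg : ∀ t > (0 : ℝ), fd t < 0)
    (hf_mlr : AntitoneOn (fun t => t * fd t / f t) (Ioi 0))
    (n : ℕ) (hn : 1 ≤ n)
    (p : ℝ) (hp : 1 ≤ p)
    (a ε K : ℝ) (hε : 0 < ε) (hK : max a 0 < K)
    -- the densities are well defined (finite normalizing constants) for every α > 0
    (h_int : ∀ α > (0 : ℝ), IntegrableOn
      (fun w => |w / K - 1| ^ (p - 1) * w ^ n * f (α * ((w - a) ^ 2 + ε))) (Ioi 0)) :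
    AntitoneOn
      (fun α =>
        (∫ w in Ioi K, |w / K - 1| ^ (p - 1) * w ^ n * f (α * ((w - a) ^ 2 + ε))) /
          (∫ w in Ioi (0 : ℝ), |w / K - 1| ^ (p - 1) * w ^ n * f (α * ((w - a) ^ 2 + ε))))
      (Ioi 0) := by
  obtain ⟨haK, hK0⟩ := max_lt_iff.1 hK
  set g : ℝ → ℝ := fun w => |w / K - 1| ^ (p - 1) * w ^ n
  have hg_nonneg : ∀ w, 0 < w → 0 ≤ g w := fun w hw => by positivity
  have hg_pos : ∀ w, 0 < w → w < K → 0 < g w := by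
    intro w hw hwK
    have h : w / K - 1 ≠ 0 := (sub_neg.2 ((div_lt_one hK0).2 hwK)).ne
    have := abs_pos.2 h
    positivity
  have hq : ∀ u : ℝ, 0 < u ^ 2 + ε := fun u => by positivity
  have hF : ∀ α > (0 : ℝ), ∀ u : ℝ, 0 < f (α * (u ^ 2 + ε)) :=
    fun α hα u => hf_pos _ (mul_pos hα (hq u))
  have hsub : Ioi K ⊆ Ioi 0 := Ioi_subset_Ioi hK0.le
  intro α (hα : 0 < α) β (hβ : 0 < β) hαβ
  set N : ℝ → ℝ := fun α => ∫ w in Ioi K, g w * f (α * ((w - a) ^ 2 + ε))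
  set D : ℝ → ℝ := fun α => ∫ w in Ioi (0 : ℝ), g w * f (α * ((w - a) ^ 2 + ε)) with hD
  change N β / D β ≤ N α / D α
  have hterm : ∀ γ > (0 : ℝ), ∀ w ∈ Ioi (0 : ℝ), 0 ≤ g w * f (γ * ((w - a) ^ 2 + ε)) :=
    fun γ hγ w hw => mul_nonneg (hg_nonneg w hw) (hF γ hγ _).le
  have hND : ∀ γ > (0 : ℝ), N γ ≤ D γ := fun γ hγ =>
    setIntegral_mono_set (h_int γ hγ)
      ((ae_restrict_iff' measurableSet_Ioi).2 (.of_forall (hterm γ hγ))) hsub.eventuallyLE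
  have hN0 : ∀ γ > (0 : ℝ), 0 ≤ N γ := fun γ hγ =>
    setIntegral_nonneg measurableSet_Ioi fun w hw => hterm γ hγ w (hsub hw)
  have hD_pos : ∀ γ > (0 : ℝ), 0 < D γ := by
    intro γ hγ
    rw [hD, setIntegral_pos_iff_support_of_nonneg_ae
      ((ae_restrict_iff' measurableSet_Ioi).2 (.of_forall (hterm γ hγ))) (h_int γ hγ)]
    refine lt_of_lt_of_le ?_ (measure_mono (s := Ioo 0 K) fun w hw =>
      ⟨(mul_pos (hg_pos w hw.1 hw.2) (hF γ hγ _)).ne', hw.1⟩)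
    simpa using hK0
  set m := N α / D α with hm
  have hm0 : 0 ≤ m := div_nonneg (hN0 α hα) (hD_pos α hα).le
  have hm1 : m ≤ 1 := (div_le_one (hD_pos α hα)).2 (hND α hα)
  set φ : ℝ → ℝ := fun w => (Ioi K).indicator g w - m * (Ioi 0).indicator g w with hφ
  have hφ_mul : ∀ γ : ℝ, (fun w => φ w * f (γ * (|w - a| ^ 2 + ε))) = fun w =>
      (Ioi K).indicator (fun w => g w * f (γ * ((w - a) ^ 2 + ε))) w -
        m * (Ioi 0).indicator (fun w => g w * f (γ * ((w - a) ^ 2 + ε))) w := by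
    intro γ
    funext w
    simp only [hφ, sq_abs, indicator_mul_left]
    ring
  have hφ_int : ∀ γ > (0 : ℝ), Integrable (fun w => φ w * f (γ * (|w - a| ^ 2 + ε))) ∧
      ∫ w, φ w * f (γ * (|w - a| ^ 2 + ε)) = N γ - m * D γ := by
    intro γ hγ
    rw [hφ_mul γ]
    have h1 := ((h_int γ hγ).mono_set hsub).integrable_indicator measurableSet_Ioi
    have h2 := ((h_int γ hγ).integrable_indicator measurableSet_Ioi).const_mul m
    refine ⟨h1.sub h2, ?_⟩
    rw [integral_sub h1 h2, integral_const_mul, integral_indicator measurableSet_Ioi,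
      integral_indicator measurableSet_Ioi]
  have hφ_gt : ∀ w, K < w → φ w = (1 - m) * g w := by
    intro w hw
    simp only [hφ, indicator_of_mem (show w ∈ Ioi K from hw),
      indicator_of_mem (show w ∈ Ioi (0 : ℝ) from hK0.trans hw)]
    ring
  have hφ_mid : ∀ w, 0 < w → w ≤ K → φ w = -(m * g w) := by
    intro w hw hwK
    simp only [hφ, indicator_of_notMem (show w ∉ Ioi K from not_lt.2 hwK),
      indicator_of_mem (show w ∈ Ioi (0 : ℝ) from hw)]
    ring
  have hφ_nonpos : ∀ w, w ≤ 0 → φ w = 0 := by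
    intro w hw
    simp [hφ, indicator_of_notMem (show w ∉ Ioi K from not_lt.2 (hw.trans hK0.le)),
      indicator_of_notMem (show w ∉ Ioi (0 : ℝ) from not_lt.2 hw)]
  have hφ_le : ∀ w, w ≤ K → φ w ≤ 0 := by
    intro w hw
    rcases le_or_gt w 0 with h | h
    · exact (hφ_nonpos w h).le
    · rw [hφ_mid w h hw]
      exact neg_nonpos.2 (mul_nonneg hm0 (hg_nonneg w h))
  have hsign : ∀ u v, 0 ≤ u → u < v → 0 < φ (a + u) + φ (a - u) →
      0 ≤ φ (a + v) + φ (a - v) := by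
    intro u v hu huv hpos
    have hKu : K < a + u := by
      by_contra! h
      linarith [hφ_le _ h, hφ_le (a - u) (by linarith)]
    rw [hφ_gt _ (by linarith)]
    rw [hφ_gt _ hKu] at hpos
    rcases le_or_gt (a - v) 0 with hv | hv
    · rw [hφ_nonpos _ hv, add_zero]
      exact mul_nonneg (by linarith) (hg_nonneg _ (by linarith))
    · rw [hφ_mid _ hv (by linarith)]
      rw [hφ_mid _ (by linarith) (by linarith)] at hpos
      have hgu : 0 < g (a - u) := hg_pos _ (by linarith) (by linarith)
      have hgv : 0 < g (a - v) := hg_pos _ hv (by linarith)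
      have hcross : g (a + u) * g (a - v) ≤ g (a + v) * g (a - u) :=
        weight_mul_reflected_le n (by linarith) hK0 haK (by linarith) huv.le (by linarith)
      refine nonneg_of_mul_nonneg_left (b := g (a - u)) ?_ hgu
      have h1 := mul_le_mul_of_nonneg_left hcross (sub_nonneg.2 hm1)
      have h2 := mul_pos hpos hgv
      linarith
  have hratio := antitoneOn_div_comp_mul hf_pos hf_deriv hf_mlr hα hαβ
  have hfinal : N β - m * D β ≤ 0 := by
    rw [← (hφ_int β hβ).2]
    refine integral_mul_nonpos_of_reflected_sign_change (A := fun u => f (α * (u ^ 2 + ε)))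
      (B := fun u => f (β * (u ^ 2 + ε))) (hF α hα) (hF β hβ) ?_ hsign (hφ_int α hα).1
      (hφ_int β hβ).1 ?_
    · intro u v hu huv
      exact hratio (hq u) (hq v) (by gcongr)
    · rw [(hφ_int α hα).2, hm, div_mul_cancel₀ _ (hD_pos α hα).ne', sub_self]
  rw [div_le_iff₀ (hD_pos β hβ)]
  linarith
end

section
/- Let q > 2 and let T be a real random variable with density f_T(t) = c_q (1+t²)^{-q/2} on ℝ, where c_q is the normalizing constant. Define g(y) = -E[T | T ≤ y] = -(∫_{-∞}^{y} t f_T(t) dt)/(∫_{-∞}^{y} f_T(t) dt) for y ∈ ℝ. Then: (i) g is strictly decreasing on ℝ; (ii) g(y) > 0 for every y ∈ ℝ; and (iii) lim_{y→∞} g(y) = 0. -/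
open MeasureTheory Set Filter

lemma setIntegral_pos_of_pos_on {f : ℝ → ℝ} {s : Set ℝ} (hs : MeasurableSet s)
    (hμ : volume s ≠ 0) (hf : IntegrableOn f s) (hpos : ∀ t ∈ s, 0 < f t) :
    0 < ∫ t in s, f t := by
  rw [setIntegral_pos_iff_support_of_nonneg_ae
    ((ae_restrict_mem hs).mono fun t ht => (hpos t ht).le) hf,
    inter_eq_right.mpr (show s ⊆ Function.support f from fun t ht => (hpos t ht).ne')]
  exact pos_iff_ne_zero.mpr hμ

/-- The mean of a positive density truncated to `(-∞, y)` is strictly increasing in `y`. -/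
lemma strictMono_truncatedMean {f : ℝ → ℝ} (hpos : ∀ t, 0 < f t) (hf : Integrable f)
    (htf : Integrable fun t => t * f t) :
    StrictMono fun y => (∫ t in Iio y, t * f t) / ∫ t in Iio y, f t := by
  intro y z hyz
  have hF (x : ℝ) : 0 < ∫ t in Iio x, f t :=
    setIntegral_pos_of_pos_on measurableSet_Iio (by simp) hf.integrableOn fun t _ => hpos t
  have hΔ : 0 < ∫ t in Ico y z, f t :=
    setIntegral_pos_of_pos_on measurableSet_Ico (by simpa using hyz) hf.integrableOn
      fun t _ => hpos t
  have hbelow : (∫ t in Iio y, t * f t) < y * ∫ t in Iio y, f t := by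
    have h : 0 < ∫ t in Iio y, (y * f t - t * f t) :=
      setIntegral_pos_of_pos_on measurableSet_Iio (by simp)
        ((hf.const_mul y).sub htf).integrableOn
        fun t ht => by nlinarith [hpos t, mem_Iio.mp ht]
    rw [integral_sub (hf.const_mul y).integrableOn htf.integrableOn, integral_const_mul] at h
    linarith
  have habove : y * (∫ t in Ico y z, f t) ≤ ∫ t in Ico y z, t * f t := by
    rw [← integral_const_mul]
    exact setIntegral_mono_on (hf.const_mul y).integrableOn htf.integrableOn measurableSet_Ico
      fun t ht => mul_le_mul_of_nonneg_right ht.1 (hpos t).le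
  have hsplit {u : ℝ → ℝ} (hu : Integrable u) :
      (∫ t in Iio z, u t) = (∫ t in Iio y, u t) + ∫ t in Ico y z, u t := by
    rw [← Iio_union_Ico_eq_Iio hyz.le]
    refine setIntegral_union ?_ measurableSet_Ico hu.integrableOn hu.integrableOn
    exact disjoint_left.mpr fun t ht ht' => not_lt_of_ge ht'.1 ht
  change _ / _ < _ / _
  rw [div_lt_div_iff₀ (hF y) (hF z), hsplit hf, hsplit htf]
  nlinarith [mul_lt_mul_of_pos_right hbelow hΔ, mul_le_mul_of_nonneg_right habove (hF y).le]

lemma tendsto_setIntegral_Iio_atTop {u : ℝ → ℝ} (hu : Integrable u) :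
    Tendsto (fun y => ∫ t in Iio y, u t) atTop (nhds (∫ t, u t)) :=
  (aecover_Iio tendsto_id).integral_tendsto_of_countably_generated hu

lemma integrable_one_add_sq_rpow_neg {r : ℝ} (hr : 1 < r) :
    Integrable fun t : ℝ => (1 + t ^ 2) ^ (-(r / 2)) := by
  simpa [neg_div] using
    integrable_rpow_neg_one_add_norm_sq (E := ℝ) (μ := volume) (r := r) (by simpa using hr)

lemma integrable_mul_one_add_sq_rpow_neg {q : ℝ} (hq : 2 < q) :
    Integrable fun t : ℝ => t * (1 + t ^ 2) ^ (-(q / 2)) := by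
  have hfac := integrable_one_add_sq_rpow_neg (r := q) (by linarith)
  refine (integrable_one_add_sq_rpow_neg (r := q - 1) (by linarith)).mono'
    (continuous_id.aestronglyMeasurable.mul hfac.aestronglyMeasurable) (.of_forall fun t => ?_)
  have hbase : 0 < 1 + t ^ 2 := by positivity
  have hsplit : (1 + t ^ 2) ^ (-((q - 1) / 2)) = √(1 + t ^ 2) * (1 + t ^ 2) ^ (-(q / 2)) := by
    rw [Real.sqrt_eq_rpow, ← Real.rpow_add hbase]
    ring_nf
  rw [hsplit, norm_mul, Real.norm_of_nonneg (Real.rpow_nonneg hbase.le _)]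
  gcongr
  exact Real.abs_le_sqrt (by linarith)

/-- Example (scale invariant squared error loss): for `T` with density
`f_T(t) = c_q (1+t²)^{-q/2}` on `ℝ` (`q > 2`), the generalized Bayes function
`g(y) = -E[T | T ≤ y]` is (i) strictly decreasing, (ii) strictly positive, and
(iii) tends to `0` as `y → ∞`. -/
theorem stmt19
    (q : ℝ) (hq : 2 < q)
    (cq : ℝ) (fT : ℝ → ℝ)
    (hfT_def : ∀ t : ℝ, fT t = cq * (1 + t ^ 2) ^ (-(q / 2)))
    (hfT_norm : (∫ t : ℝ, fT t) = 1)
    (g : ℝ → ℝ)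
    (hg_def : ∀ y : ℝ, g y = -(∫ t in Iio y, t * fT t) / (∫ t in Iio y, fT t)) :
    StrictAnti g ∧ (∀ y : ℝ, 0 < g y) ∧ Tendsto g atTop (nhds 0) := by
  have hint : Integrable fT := by
    simpa only [← hfT_def] using
      (integrable_one_add_sq_rpow_neg (r := q) (by linarith)).const_mul cq
  have htint : Integrable fun t => t * fT t := by
    simpa only [hfT_def, mul_left_comm] using
      (integrable_mul_one_add_sq_rpow_neg hq).const_mul cq
  have hcq : 0 < cq := by
    simp only [hfT_def, integral_const_mul] at hfT_norm
    have hI : 0 ≤ ∫ t : ℝ, (1 + t ^ 2) ^ (-(q / 2)) :=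
      integral_nonneg fun t => by positivity
    exact pos_of_mul_pos_left (one_pos.trans_eq hfT_norm.symm) hI
  have hpos (t : ℝ) : 0 < fT t := by
    rw [hfT_def]
    positivity
  have hmean : ∫ t, t * fT t = 0 := by
    have h := integral_neg_eq_self (fun t => t * fT t) volume
    simp only [hfT_def, neg_sq, neg_mul, integral_neg] at h ⊢
    linarith
  have hanti : StrictAnti g := fun y z hyz => by
    simpa only [hg_def, neg_div] using neg_lt_neg (strictMono_truncatedMean hpos hint htint hyz)
  have hlim : Tendsto g atTop (nhds 0) := by
    have h := (tendsto_setIntegral_Iio_atTop htint).neg.div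
      (tendsto_setIntegral_Iio_atTop hint) (by simp [hfT_norm])
    rw [hmean, neg_zero, zero_div] at h
    exact h.congr fun y => (hg_def y).symm
  exact ⟨hanti, fun y => (hanti.antitone.le_of_tendsto hlim (y + 1)).trans_lt
    (hanti (lt_add_one y)), hlim⟩
end
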